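/- Let N ≥ 3. There exists a constant K_N > 0, depending only on N, such that for every open connected set Ω ⊊ ℝ^N and every u ∈ C_0^∞(Ω) one has ∫_Ω (|∇u|² − |u|²/(4 D_Ω(x)²)) dx ≥ K_N (∫_Ω |u|^{2N/(N−2)} dx)^{(N−2)/N}. -/

import Mathlib

open MeasureTheory Metric Set

noncomputable def dirDist {N : ℕ} (Ω : Set (EuclideanSpace ℝ (Fin N)))
    (x e : EuclideanSpace ℝ (Fin N)) : ℝ :=
  sInf {r : ℝ | ∃ t : ℝ, r = |t| ∧ x + t • e ∈ Ωᶜ}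

noncomputable def daviesWeight {N : ℕ} (Ω : Set (EuclideanSpace ℝ (Fin N)))
    (x : EuclideanSpace ℝ (Fin N)) : ℝ :=
  ((N : ℝ) * ⨍ e : sphere (0 : EuclideanSpace ℝ (Fin N)) 1,
      (dirDist Ω x (e : EuclideanSpace ℝ (Fin N)) ^ 2)⁻¹ ∂volume.toSphere) ^ (-(1:ℝ)/2)

theorem sq_intervalIntegral_mul_le {f g : ℝ → ℝ} {a b : ℝ} (hab : a ≤ b)
    (hf : ContinuousOn f (Icc a b)) (hg : ContinuousOn g (Icc a b)) :
    (∫ x in a..b, f x * g x) ^ 2 ≤ (∫ x in a..b, f x ^ 2) * ∫ x in a..b, g x ^ 2 := by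
  have hii {h : ℝ → ℝ} (hh : ContinuousOn h (Icc a b)) : IntervalIntegrable h volume a b :=
    ContinuousOn.intervalIntegrable (by rwa [uIcc_of_le hab])
  have key (r : ℝ) : 0 ≤ (∫ x in a..b, f x ^ 2) * (r * r) + (2 * ∫ x in a..b, f x * g x) * r
      + ∫ x in a..b, g x ^ 2 := by
    have h0 : 0 ≤ ∫ x in a..b, (r * f x + g x) ^ 2 :=
      intervalIntegral.integral_nonneg hab fun x _ => sq_nonneg _
    have h1 : (fun x => (r * f x + g x) ^ 2)
        = fun x => (r * r) * f x ^ 2 + (2 * r) * (f x * g x) + g x ^ 2 := by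
      ext x; ring
    rw [h1, intervalIntegral.integral_add, intervalIntegral.integral_add,
      intervalIntegral.integral_const_mul, intervalIntegral.integral_const_mul] at h0
    · linarith
    · exact hii (continuousOn_const.mul (hf.pow 2))
    · exact hii (continuousOn_const.mul (hf.mul hg))
    · exact hii ((continuousOn_const.mul (hf.pow 2)).add (continuousOn_const.mul (hf.mul hg)))
    · exact hii (hg.pow 2)
  have := discrim_le_zero key
  unfold discrim at this
  linarith

/-- A function vanishing near `a`, divided by the distance to `a`, is continuous. -/
theorem continuous_div_sub_of_eventually_zero {f : ℝ → ℝ} {a : ℝ} (hf : Continuous f)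
    (h0 : ∀ᶠ x in nhds a, f x = 0) : Continuous fun x => f x / (x - a) := by
  rw [continuous_iff_continuousAt]
  intro x
  rcases eq_or_ne x a with rfl | hx
  · refine (continuousAt_const (y := (0 : ℝ))).congr ?_
    filter_upwards [h0] with y hy
    simp [hy]
  · exact hf.continuousAt.div (by fun_prop) (sub_ne_zero.2 hx)

/-- Completing the square: on a half interval, the Hardy functional equals the integral of
a square plus a boundary term. -/
theorem hardy_half_interval_identity {f : ℝ → ℝ} {a m : ℝ} (hf : ContDiff ℝ 1 f)
    (h0 : ∀ᶠ x in nhds a, f x = 0) :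
    ∫ x in a..m, (deriv f x ^ 2 - (f x / (x - a)) ^ 2 / 4) =
      (∫ x in a..m, (deriv f x - f x / (x - a) / 2) ^ 2) + f m ^ 2 / (2 * (m - a)) := by
  have hv := continuous_div_sub_of_eventually_zero hf.continuous h0
  have hd : Continuous (deriv f) := hf.continuous_deriv le_rfl
  have hder (x : ℝ) : HasDerivAt (fun x => f x * (f x / (x - a)) / 2)
      (deriv f x * (f x / (x - a)) - (f x / (x - a)) ^ 2 / 2) x := by
    rcases eq_or_ne x a with rfl | hx
    · have : HasDerivAt (fun _ : ℝ => (0 : ℝ)) 0 x := hasDerivAt_const _ _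
      have h2 : HasDerivAt (fun y => f y * (f y / (y - x)) / 2) 0 x :=
        this.congr_of_eventuallyEq (by filter_upwards [h0] with y hy; simp [hy])
      simpa using h2
    · have hfx : HasDerivAt f (deriv f x) x := (hf.differentiable one_ne_zero x).hasDerivAt
      have hs : HasDerivAt (fun x => x - a) 1 x := (hasDerivAt_id x).sub_const a
      have hxa : x - a ≠ 0 := sub_ne_zero.2 hx
      refine ((hfx.mul (hfx.div hs hxa)).div_const 2).congr_deriv ?_
      simp only [Pi.div_apply]
      field_simp
      ring
  have hint : IntervalIntegrable
      (fun x => deriv f x * (f x / (x - a)) - (f x / (x - a)) ^ 2 / 2) volume a m :=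
    Continuous.intervalIntegrable (by fun_prop) _ _
  have hftc := intervalIntegral.integral_eq_sub_of_hasDerivAt (fun x _ => hder x) hint
  have hsplit : (fun x => deriv f x ^ 2 - (f x / (x - a)) ^ 2 / 4)
      = fun x => (deriv f x - f x / (x - a) / 2) ^ 2
        + (deriv f x * (f x / (x - a)) - (f x / (x - a)) ^ 2 / 2) := by
    ext x; ring
  rw [hsplit, intervalIntegral.integral_add (Continuous.intervalIntegrable (by fun_prop) _ _) hint,
    hftc]
  simp
  rw [← mul_div_assoc, div_div, ← sq, mul_comm 2]

/-- The quotient of `|f| ^ p` by the power `p / 2` of the distance to `a` varies little between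
two points, relative to the Hardy functional. -/
theorem abs_sub_le_of_ground_state {f : ℝ → ℝ} {a m s p q : ℝ} (hf : ContDiff ℝ 1 f)
    (h0 : ∀ᶠ x in nhds a, f x = 0) (hq : 2 ≤ q) (hp : p = q / 2 + 1) (has : a < s) (hsm : s ≤ m) :
    |(|f m| ^ p * (m - a) ^ (-(p / 2))) - |f s| ^ p * (s - a) ^ (-(p / 2))| ≤
      p * (s - a) ^ (-(p / 2)) *
        √((∫ x in a..m, |f x| ^ q) * ∫ x in a..m, (deriv f x - f x / (x - a) / 2) ^ 2) := by
  have hv := continuous_div_sub_of_eventually_zero hf.continuous h0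
  have hd : Continuous (deriv f) := hf.continuous_deriv le_rfl
  have hfc := hf.continuous
  have hp1 : 1 < p := by linarith
  have hsa : 0 < s - a := by linarith
  set k : ℝ → ℝ := fun x => deriv f x - f x / (x - a) / 2 with hk
  have hkc : Continuous k := by fun_prop
  have hgc : Continuous fun x => |f x| ^ (q / 2) :=
    hfc.abs.rpow_const fun x => Or.inr (by linarith)
  set D : ℝ → ℝ := fun x => p * |f x| ^ (p - 2) * f x * deriv f x * (x - a) ^ (-(p / 2))
    + |f x| ^ p * (-(p / 2) * (x - a) ^ (-(p / 2) - 1)) with hD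
  have hder (x : ℝ) (hx : a < x) :
      HasDerivAt (fun x => |f x| ^ p * (x - a) ^ (-(p / 2))) (D x) x := by
    have hfx : HasDerivAt f (deriv f x) x := (hf.differentiable one_ne_zero x).hasDerivAt
    have h1 := (hasDerivAt_abs_rpow (f x) hp1).comp x hfx
    have hs : HasDerivAt (fun x => x - a) 1 x := (hasDerivAt_id x).sub_const a
    have h2 := hs.rpow_const (p := -(p / 2)) (Or.inl (by linarith))
    refine (h1.mul h2).congr_deriv ?_
    simp only [hD, Function.comp]
    ring
  have hDle (x : ℝ) (hx : x ∈ Icc s m) :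
      ‖D x‖ ≤ (p * (s - a) ^ (-(p / 2))) * (|f x| ^ (q / 2) * |k x|) := by
    have hxa : 0 < x - a := by linarith [hx.1]
    have e1 : (x - a) ^ (-(p / 2) - 1) = (x - a) ^ (-(p / 2)) / (x - a) := by
      rw [Real.rpow_sub_one hxa.ne']
    have e2 : |f x| ^ p = |f x| ^ (p - 2) * f x * f x := by
      rcases eq_or_ne (f x) 0 with h | h
      · rw [h]; simp [(by linarith : p ≠ 0)]
      · rw [mul_assoc, ← sq, ← sq_abs, ← Real.rpow_natCast, ← Real.rpow_add (abs_pos.2 h)]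
        norm_num
    have e3 : |(|f x| ^ (p - 2) * f x)| = |f x| ^ (q / 2) := by
      rcases eq_or_ne (f x) 0 with h | h
      · rw [h]; simp [(by linarith : q ≠ 0)]
      · rw [abs_mul, abs_of_nonneg (Real.rpow_nonneg (abs_nonneg _) _)]
        rw [← Real.rpow_add_one (abs_pos.2 h).ne', hp]
        congr 1; ring
    have e4 : D x = p * (x - a) ^ (-(p / 2)) * ((|f x| ^ (p - 2) * f x) * k x) := by
      simp only [hD, hk, e1, e2]
      field_simp
      ring
    rw [e4, Real.norm_eq_abs, abs_mul, abs_mul (_ * _) (k x), e3, abs_of_nonneg (by positivity)]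
    gcongr ?_ * _
    gcongr p * ?_
    exact Real.rpow_le_rpow_of_nonpos hsa (by linarith [hx.1]) (by linarith)
  have hDc : ContinuousOn D (Icc s m) := by
    have : ∀ x ∈ Icc s m, x - a ≠ 0 := fun x hx => by linarith [hx.1]
    have c1 : ContinuousOn (fun x => (x - a) ^ (-(p / 2))) (Icc s m) :=
      ContinuousOn.rpow_const (by fun_prop) fun x hx => Or.inl (this x hx)
    have c2 : ContinuousOn (fun x => (x - a) ^ (-(p / 2) - 1)) (Icc s m) :=
      ContinuousOn.rpow_const (by fun_prop) fun x hx => Or.inl (this x hx)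
    have c3 : Continuous fun x => |f x| ^ (p - 2) :=
      hfc.abs.rpow_const fun x => Or.inr (by linarith)
    have c4 : Continuous fun x => |f x| ^ p :=
      hfc.abs.rpow_const fun x => Or.inr (by linarith)
    exact ((((continuous_const.mul c3).mul hfc).mul hd).continuousOn.mul c1).add
      (c4.continuousOn.mul (continuousOn_const.mul c2))
  have hii : IntervalIntegrable D volume s m :=
    ContinuousOn.intervalIntegrable (by rwa [uIcc_of_le hsm])
  have hftc := intervalIntegral.integral_eq_sub_of_hasDerivAt
    (f := fun x => |f x| ^ p * (x - a) ^ (-(p / 2))) (f' := D) (a := s) (b := m)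
    (fun x hx => hder x (by rw [uIcc_of_le hsm] at hx; linarith [hx.1])) hii
  rw [← hftc, ← Real.norm_eq_abs]
  refine (intervalIntegral.norm_integral_le_of_norm_le (g := fun x =>
    (p * (s - a) ^ (-(p / 2))) * (|f x| ^ (q / 2) * |k x|)) hsm
    (Filter.Eventually.of_forall fun x hx => hDle x ⟨hx.1.le, hx.2⟩)
    (Continuous.intervalIntegrable (continuous_const.mul (hgc.mul hkc.abs)) _ _)).trans ?_
  rw [intervalIntegral.integral_const_mul]
  gcongr
  refine Real.le_sqrt_of_sq_le ((sq_intervalIntegral_mul_le hsm hgc.continuousOn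
    hkc.abs.continuousOn).trans ?_)
  have hqc : Continuous fun x => |f x| ^ q :=
    hfc.abs.rpow_const fun x => Or.inr (by linarith)
  have e5 : (fun x => (|f x| ^ (q / 2)) ^ 2) = fun x => |f x| ^ q := by
    ext x
    rw [← Real.rpow_natCast, ← Real.rpow_mul (abs_nonneg _)]
    congr 1; push_cast; ring
  simp only [sq_abs]
  rw [e5]
  have mono {g : ℝ → ℝ} (hg : Continuous g) (h : ∀ x, 0 ≤ g x) :
      ∫ x in s..m, g x ≤ ∫ x in a..m, g x :=
    intervalIntegral.integral_mono_interval has.le hsm le_rfl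
      (Filter.Eventually.of_forall h) (hg.intervalIntegrable _ _)
  refine mul_le_mul (mono hqc fun x => by positivity) (mono (by fun_prop) fun x => sq_nonneg _)
    (intervalIntegral.integral_nonneg hsm fun x _ => sq_nonneg _)
    (intervalIntegral.integral_nonneg (by linarith) fun x _ => by positivity)

/-- The constant in the one-dimensional inequality, before squaring. -/
noncomputable def lineConst (p : ℝ) : ℝ := 2 ^ (p / 2) * (2 + p) + p

theorem lineConst_pos {p : ℝ} (hp : 0 < p) : 0 < lineConst p := by
  unfold lineConst; positivity

theorem rpow_le_of_hardy_half_interval {f : ℝ → ℝ} {a m q : ℝ} (hf : ContDiff ℝ 1 f)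
    (h0 : ∀ᶠ x in nhds a, f x = 0) (hq : 2 ≤ q) (ham : a < m) :
    0 ≤ ∫ x in a..m, (deriv f x ^ 2 - (f x / (x - a)) ^ 2 / 4) ∧
    ∀ t ∈ Ioc a m, |f t| ^ (q + 2) ≤ lineConst (q / 2 + 1) ^ 2 *
      (∫ x in a..m, (deriv f x ^ 2 - (f x / (x - a)) ^ 2 / 4)) * ∫ x in a..m, |f x| ^ q := by
  have hid := hardy_half_interval_identity (m := m) hf h0
  set E := ∫ x in a..m, (deriv f x ^ 2 - (f x / (x - a)) ^ 2 / 4)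
  set J := ∫ x in a..m, (deriv f x - f x / (x - a) / 2) ^ 2 with hJ
  set h := ∫ x in a..m, |f x| ^ q with hh
  obtain ⟨p, hp⟩ : ∃ p, p = q / 2 + 1 := ⟨_, rfl⟩
  have hM : 0 < m - a := by linarith
  have hJ0 : 0 ≤ J := intervalIntegral.integral_nonneg ham.le fun x _ => sq_nonneg _
  have hh0 : 0 ≤ h := intervalIntegral.integral_nonneg ham.le fun x _ => by positivity
  have hqc : Continuous fun x => |f x| ^ q :=
    hf.continuous.abs.rpow_const fun x => Or.inr (by linarith)
  have hbd0 : 0 ≤ f m ^ 2 / (2 * (m - a)) := by positivity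
  have hE0 : 0 ≤ E := by linarith
  refine ⟨hE0, ?_⟩
  set R := √(h * E) with hR
  have hR0 : 0 ≤ R := Real.sqrt_nonneg _
  have hfm : f m ^ 2 ≤ 2 * (m - a) * E := by
    have : f m ^ 2 / (2 * (m - a)) ≤ E := by linarith
    rwa [div_le_iff₀ (by positivity), mul_comm] at this
  have hvar (s : ℝ) (has : a < s) (hsm : s ≤ m) :
      |(|f m| ^ p * (m - a) ^ (-(p / 2))) - |f s| ^ p * (s - a) ^ (-(p / 2))| ≤
      p * (s - a) ^ (-(p / 2)) * R := by
    refine (abs_sub_le_of_ground_state hf h0 hq hp has hsm).trans ?_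
    have : 0 < p := by linarith
    have : 0 < s - a := by linarith
    have hJE : J ≤ E := by linarith
    gcongr
    exact Real.sqrt_le_sqrt (mul_le_mul_of_nonneg_left hJE hh0)
  have hinv (s : ℝ) (has : a < s) : (s - a) ^ (p / 2) * (s - a) ^ (-(p / 2)) = 1 := by
    rw [← Real.rpow_add (by linarith)]; simp
  have hup (s : ℝ) (has : a < s) (hsm : s ≤ m) : |f s| ^ p ≤ |f m| ^ p + p * R := by
    have h1 := (abs_le.1 (hvar s has hsm)).1
    have hs : 0 < s - a := by linarith
    have hle : (s - a) ^ (p / 2) * (m - a) ^ (-(p / 2)) ≤ 1 := by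
      rw [← hinv s has]
      gcongr ?_ * ?_
      exact Real.rpow_le_rpow_of_nonpos hs (by linarith) (by linarith)
    have h2 := mul_le_mul_of_nonneg_left h1 (Real.rpow_nonneg hs.le (p / 2))
    have h3 := hinv s has
    have h4 : (s - a) ^ (p / 2) * (m - a) ^ (-(p / 2)) * |f m| ^ p ≤ 1 * |f m| ^ p := by gcongr
    have h5 : (s - a) ^ (p / 2) * (-(p * (s - a) ^ (-(p / 2)) * R)) = -(p * R) := by
      linear_combination (-(p * R)) * h3
    have h6 : (s - a) ^ (p / 2) * (|f m| ^ p * (m - a) ^ (-(p / 2))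
        - |f s| ^ p * (s - a) ^ (-(p / 2)))
        = (s - a) ^ (p / 2) * (m - a) ^ (-(p / 2)) * |f m| ^ p - |f s| ^ p := by
      linear_combination (-(|f s| ^ p)) * h3
    linarith
  have hdown (s : ℝ) (has : (a + m) / 2 ≤ s) (hsm : s ≤ m) :
      |f m| ^ p ≤ 2 ^ (p / 2) * (|f s| ^ p + p * R) := by
    have has' : a < s := by linarith
    have h1 := (abs_le.1 (hvar s has' hsm)).2
    have hs : 0 < s - a := by linarith
    have hle : (m - a) ^ (p / 2) * (s - a) ^ (-(p / 2)) ≤ 2 ^ (p / 2) := by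
      calc (m - a) ^ (p / 2) * (s - a) ^ (-(p / 2))
          ≤ (2 * (s - a)) ^ (p / 2) * (s - a) ^ (-(p / 2)) := by
            gcongr
            · linarith
            · linarith
        _ = 2 ^ (p / 2) := by
            rw [Real.mul_rpow (by norm_num) hs.le, mul_assoc, hinv s has', mul_one]
    have h2 := mul_le_mul_of_nonneg_left h1 (Real.rpow_nonneg hM.le (p / 2))
    have h3 := hinv m ham
    have hp0 : 0 < p := by linarith
    calc |f m| ^ p = (m - a) ^ (p / 2) * (|f m| ^ p * (m - a) ^ (-(p / 2))) := by
          linear_combination (-(|f m| ^ p)) * h3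
      _ ≤ ((m - a) ^ (p / 2) * (s - a) ^ (-(p / 2))) * (|f s| ^ p + p * R) := by linarith
      _ ≤ _ := by gcongr
  obtain ⟨s, hs, hsh⟩ : ∃ s ∈ Icc ((a + m) / 2) m, (m - a) / 2 * |f s| ^ q ≤ h := by
    by_contra! hcon
    have h1 : ∫ x in ((a + m) / 2)..m, (h / ((m - a) / 2)) < ∫ x in ((a + m) / 2)..m, |f x| ^ q := by
      refine intervalIntegral.integral_lt_integral_of_continuousOn_of_le_of_exists_lt
        (by linarith) continuousOn_const hqc.continuousOn (fun x hx => ?_) ⟨m, ⟨by linarith, le_rfl⟩, ?_⟩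
      · rw [div_le_iff₀ (by positivity), mul_comm]
        exact (hcon x ⟨hx.1.le, hx.2⟩).le
      · rw [div_lt_iff₀ (by positivity), mul_comm]
        exact hcon m ⟨by linarith, le_rfl⟩
    have h2 : ∫ x in ((a + m) / 2)..m, |f x| ^ q ≤ h :=
      intervalIntegral.integral_mono_interval (by linarith) (by linarith) le_rfl
        (Filter.Eventually.of_forall fun x => by positivity) (hqc.intervalIntegrable _ _)
    rw [intervalIntegral.integral_const, smul_eq_mul,
      (by ring : m - (a + m) / 2 = (m - a) / 2), mul_div_cancel₀ _ (by positivity)] at h1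
    linarith
  have hmix : |f s| ^ (q / 2) * |f m| ≤ 2 * R := by
    refine le_trans ?_ (show √(4 * (h * E)) ≤ 2 * R by
      rw [Real.sqrt_mul (by norm_num), (by norm_num : (4 : ℝ) = 2 ^ 2),
        Real.sqrt_sq (by norm_num)])
    refine Real.le_sqrt_of_sq_le ?_
    have e : (|f s| ^ (q / 2)) ^ 2 = |f s| ^ q := by
      rw [← Real.rpow_natCast, ← Real.rpow_mul (abs_nonneg _)]
      congr 1; push_cast; ring
    rw [mul_pow, e, sq_abs]
    have h1 := mul_le_mul_of_nonneg_right hsh hE0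
    calc |f s| ^ q * f m ^ 2 ≤ |f s| ^ q * (2 * (m - a) * E) := by gcongr
      _ = 4 * ((m - a) / 2 * |f s| ^ q * E) := by ring
      _ ≤ 4 * (h * E) := by linarith
  have hrec (y : ℝ) (hy : 0 ≤ y) : y ^ p = y ^ (q / 2) * y := by
    rw [hp, Real.rpow_add_one' hy (by linarith)]
  have hp0 : 0 < p := by linarith
  have h2p : 1 ≤ (2 : ℝ) ^ (p / 2) := Real.one_le_rpow (by norm_num) (by linarith)
  have hfmR : |f m| ^ p ≤ 2 ^ (p / 2) * (2 * R + p * R) := by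
    rcases le_total |f m| |f s| with hle | hle
    · have h1 : |f m| ^ p ≤ 2 * R := by
        rw [hrec _ (abs_nonneg _)]
        refine le_trans ?_ hmix
        gcongr
      have h2 : 1 * (2 * R + p * R) ≤ 2 ^ (p / 2) * (2 * R + p * R) := by gcongr
      have := mul_nonneg hp0.le hR0
      linarith
    · refine (hdown s hs.1 hs.2).trans ?_
      gcongr
      rw [hrec _ (abs_nonneg _)]
      refine le_trans ?_ hmix
      gcongr
  intro t ht
  have hfin : |f t| ^ p ≤ lineConst p * R := by
    have := hup t ht.1 ht.2
    unfold lineConst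
    linarith
  rw [← hp]
  have e : |f t| ^ (q + 2) = (|f t| ^ p) ^ 2 := by
    rw [← Real.rpow_natCast, ← Real.rpow_mul (abs_nonneg _)]
    congr 1; rw [hp]; push_cast; ring
  calc |f t| ^ (q + 2) = (|f t| ^ p) ^ 2 := e
    _ ≤ (lineConst p * R) ^ 2 := by gcongr
    _ = lineConst p ^ 2 * (h * E) := by rw [mul_pow, hR, Real.sq_sqrt (by positivity)]
    _ = _ := by ring

/-- One-dimensional Hardy inequality with a remainder `e` controlling the values of `f`,
on a half interval. -/
theorem exists_hardy_remainder_Ioc {f : ℝ → ℝ} {a m q : ℝ} (hf : ContDiff ℝ 1 f)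
    (h0 : ∀ᶠ x in nhds a, f x = 0) (hq : 2 ≤ q) (ham : a < m) (W : ℝ → ENNReal)
    (hW : ∀ x ∈ Ioc a m, W x ≤ ENNReal.ofReal ((x - a) ^ 2)⁻¹) :
    ∃ e : ENNReal, (∫⁻ x in Ioc a m, ENNReal.ofReal (f x ^ 2 / 4) * W x) + e ≤
        ∫⁻ x in Ioc a m, ENNReal.ofReal (deriv f x ^ 2) ∧
      ∀ t ∈ Ioc a m, ENNReal.ofReal (|f t| ^ (q + 2)) ≤
        ENNReal.ofReal (lineConst (q / 2 + 1) ^ 2) * e * ∫⁻ x, ENNReal.ofReal (|f x| ^ q) := by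
  obtain ⟨hE, ht⟩ := rpow_le_of_hardy_half_interval hf h0 hq ham
  have hv := continuous_div_sub_of_eventually_zero hf.continuous h0
  have hd : Continuous (deriv f) := hf.continuous_deriv le_rfl
  have hqc : Continuous fun x => |f x| ^ q :=
    hf.continuous.abs.rpow_const fun x => Or.inr (by linarith)
  have conv {g : ℝ → ℝ} (hg : Continuous g) (h : ∀ x, 0 ≤ g x) :
      ∫⁻ x in Ioc a m, ENNReal.ofReal (g x) = ENNReal.ofReal (∫ x in a..m, g x) := by
    rw [intervalIntegral.integral_of_le ham.le, ofReal_integral_eq_lintegral_ofReal]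
    · exact (hg.intervalIntegrable a m).1
    · exact Filter.Eventually.of_forall h
  refine ⟨ENNReal.ofReal (∫ x in a..m, (deriv f x ^ 2 - (f x / (x - a)) ^ 2 / 4)), ?_, ?_⟩
  · have h1 : (∫⁻ x in Ioc a m, ENNReal.ofReal (f x ^ 2 / 4) * W x) ≤
        ∫⁻ x in Ioc a m, ENNReal.ofReal ((f x / (x - a)) ^ 2 / 4) := by
      refine setLIntegral_mono' measurableSet_Ioc fun x hx => ?_
      calc ENNReal.ofReal (f x ^ 2 / 4) * W x
          ≤ ENNReal.ofReal (f x ^ 2 / 4) * ENNReal.ofReal ((x - a) ^ 2)⁻¹ := by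
            gcongr; exact hW x hx
        _ = _ := by
            rw [← ENNReal.ofReal_mul (by positivity)]
            congr 1; rw [div_pow]; ring
    refine (add_le_add_left h1 _).trans ?_
    rw [conv (by fun_prop) fun x => by positivity, conv (by fun_prop) fun x => sq_nonneg _,
      ← ENNReal.ofReal_add (intervalIntegral.integral_nonneg ham.le fun x _ => by positivity) hE,
      intervalIntegral.integral_sub (Continuous.intervalIntegrable (by fun_prop) _ _)
        (Continuous.intervalIntegrable (by fun_prop) _ _)]
    simp
  · intro t ht'
    refine (ENNReal.ofReal_le_ofReal (ht t ht')).trans ?_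
    rw [ENNReal.ofReal_mul (mul_nonneg (sq_nonneg _) hE), ENNReal.ofReal_mul (sq_nonneg _),
      ← conv hqc fun x => by positivity]
    gcongr
    exact Measure.restrict_le_self

theorem exists_hardy_remainder_Ico {f : ℝ → ℝ} {m b q : ℝ} (hf : ContDiff ℝ 1 f)
    (h0 : ∀ᶠ x in nhds b, f x = 0) (hq : 2 ≤ q) (hmb : m < b) (W : ℝ → ENNReal)
    (hW : ∀ x ∈ Ico m b, W x ≤ ENNReal.ofReal ((b - x) ^ 2)⁻¹) :
    ∃ e : ENNReal, (∫⁻ x in Ico m b, ENNReal.ofReal (f x ^ 2 / 4) * W x) + e ≤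
        ∫⁻ x in Ico m b, ENNReal.ofReal (deriv f x ^ 2) ∧
      ∀ t ∈ Ico m b, ENNReal.ofReal (|f t| ^ (q + 2)) ≤
        ENNReal.ofReal (lineConst (q / 2 + 1) ^ 2) * e * ∫⁻ x, ENNReal.ofReal (|f x| ^ q) := by
  have h0' : ∀ᶠ x in nhds (-b), f (-x) = 0 := by
    have : Filter.Tendsto (fun x : ℝ => -x) (nhds (-b)) (nhds b) := by
      simpa using (continuous_neg (G := ℝ)).tendsto (-b)
    exact this.eventually h0
  obtain ⟨e, he, ht⟩ := exists_hardy_remainder_Ioc (f := fun x => f (-x)) (a := -b) (m := -m)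
    (hf.comp contDiff_neg) h0' hq (by linarith) (fun x => W (-x)) (fun x hx => by
      have := hW (-x) ⟨by linarith [hx.2], by linarith [hx.1]⟩
      rwa [show b - -x = x - -b by ring] at this)
  have conv (g : ℝ → ENNReal) : ∫⁻ x in Ioc (-b) (-m), g (-x) = ∫⁻ x in Ico m b, g x := by
    have := (Measure.measurePreserving_neg (volume : Measure ℝ)).setLIntegral_comp_preimage_emb
      (MeasurableEquiv.neg ℝ).measurableEmbedding g (Ico m b)
    rw [← this]
    simp
  refine ⟨e, ?_, fun t htm => ?_⟩
  · simp only [deriv_comp_neg, neg_sq] at he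
    rwa [conv (fun x => ENNReal.ofReal (f x ^ 2 / 4) * W x),
      conv (fun x => ENNReal.ofReal (deriv f x ^ 2))] at he
  · have := ht (-t) ⟨by linarith [htm.2], by linarith [htm.1]⟩
    rw [lintegral_neg_eq_self (fun x => ENNReal.ofReal (|f x| ^ q))] at this
    simpa using this

theorem exists_hardy_remainder_Ioo {f : ℝ → ℝ} {a b q : ℝ} (hf : ContDiff ℝ 1 f)
    (ha : ∀ᶠ x in nhds a, f x = 0) (hb : ∀ᶠ x in nhds b, f x = 0) (hq : 2 ≤ q) (hab : a < b)
    (W : ℝ → ENNReal)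
    (hW : ∀ x ∈ Ioo a b, W x ≤ ENNReal.ofReal (min (x - a) (b - x) ^ 2)⁻¹) :
    ∃ e : ENNReal, (∫⁻ x in Ioo a b, ENNReal.ofReal (f x ^ 2 / 4) * W x) + e ≤
        ∫⁻ x in Ioo a b, ENNReal.ofReal (deriv f x ^ 2) ∧
      ∀ t ∈ Ioo a b, ENNReal.ofReal (|f t| ^ (q + 2)) ≤
        ENNReal.ofReal (lineConst (q / 2 + 1) ^ 2) * e * ∫⁻ x, ENNReal.ofReal (|f x| ^ q) := by
  obtain ⟨m, hm⟩ : ∃ m, m = (a + b) / 2 := ⟨_, rfl⟩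
  have ham : a < m := by linarith
  have hmb : m < b := by linarith
  obtain ⟨e₁, h₁, k₁⟩ := exists_hardy_remainder_Ioc hf ha hq ham W fun x hx => by
    have := hW x ⟨hx.1, by linarith [hx.2]⟩
    rwa [min_eq_left (by linarith [hx.2])] at this
  obtain ⟨e₂, h₂, k₂⟩ := exists_hardy_remainder_Ico hf hb hq hmb W fun x hx => by
    have := hW x ⟨by linarith [hx.1], hx.2⟩
    rwa [min_eq_right (by linarith [hx.1])] at this
  have conv (g : ℝ → ENNReal) :
      ∫⁻ x in Ioo a b, g x = (∫⁻ x in Ioc a m, g x) + ∫⁻ x in Ico m b, g x := by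
    rw [← Ioc_union_Ioo_eq_Ioo ham.le hmb, lintegral_union measurableSet_Ioo
      (Set.disjoint_left.2 fun x hx hx' => absurd hx.2 (not_le.2 hx'.1)),
      setLIntegral_congr (Ioo_ae_eq_Ico (a := m) (b := b))]
  refine ⟨e₁ + e₂, ?_, fun t ht => ?_⟩
  · rw [conv, conv]
    calc _ = ((∫⁻ x in Ioc a m, ENNReal.ofReal (f x ^ 2 / 4) * W x) + e₁) +
          ((∫⁻ x in Ico m b, ENNReal.ofReal (f x ^ 2 / 4) * W x) + e₂) := by ring
      _ ≤ _ := add_le_add h₁ h₂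
  · rcases le_total t m with h | h
    · refine (k₁ t ⟨ht.1, h⟩).trans ?_
      gcongr
      exact le_self_add
    · refine (k₂ t ⟨h, ht.2⟩).trans ?_
      gcongr
      exact le_add_self

/-- The distance from `t` to the complement of `O ⊆ ℝ`, with value `0` if `O` is everything. -/
noncomputable def lineDist (O : Set ℝ) (t : ℝ) : ℝ := sInf {r : ℝ | ∃ s : ℝ, r = |s| ∧ t + s ∈ Oᶜ}

theorem inv_lineDist_sq_le {O : Set ℝ} {a b x : ℝ} (hO : Ioo a b ⊆ O) (hx : x ∈ Ioo a b) :
    (lineDist O x ^ 2)⁻¹ ≤ (min (x - a) (b - x) ^ 2)⁻¹ := by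
  have hpos : 0 < min (x - a) (b - x) := lt_min (by linarith [hx.1]) (by linarith [hx.2])
  rcases Set.eq_empty_or_nonempty {r : ℝ | ∃ s : ℝ, r = |s| ∧ x + s ∈ Oᶜ} with h | h
  · rw [lineDist, h]
    simp only [Real.sInf_empty]
    norm_num
    positivity
  · have : min (x - a) (b - x) ≤ lineDist O x := by
      refine le_csInf h ?_
      rintro r ⟨s, rfl, hs⟩
      by_contra! hlt
      have h1 := lt_min_iff.1 hlt
      refine hs (hO ⟨?_, ?_⟩)
      · linarith [neg_abs_le s]
      · linarith [le_abs_self s]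
    gcongr

theorem connectedComponentIn_eq_Ioo {O : Set ℝ} (hO : IsOpen O) (hbb : BddBelow O)
    (hba : BddAbove O) {x : ℝ} (hx : x ∈ O) :
    ∃ a b, a < b ∧ a ∉ O ∧ b ∉ O ∧ connectedComponentIn O x = Ioo a b := by
  set C := connectedComponentIn O x
  have hCO : C ⊆ O := connectedComponentIn_subset O x
  have hCo : IsOpen C := hO.connectedComponentIn
  have hxC : x ∈ C := mem_connectedComponentIn hx
  have hCc : IsConnected C := isConnected_connectedComponentIn_iff.2 hx
  have hb := hbb.mono hCO
  have ha := hba.mono hCO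
  have hmem {y : ℝ} (hyO : y ∈ O) (hy : y ∈ closure C) : y ∈ C := by
    have hD : IsOpen (connectedComponentIn O y) := hO.connectedComponentIn
    obtain ⟨z, hz1, hz2⟩ := mem_closure_iff.1 hy _ hD (mem_connectedComponentIn hyO)
    have e : C = connectedComponentIn O y :=
      (connectedComponentIn_eq hz2).trans (connectedComponentIn_eq hz1).symm
    rw [e]
    exact mem_connectedComponentIn hyO
  have hinf : sInf C ∉ C := fun h => by
    obtain ⟨ε, hε, hball⟩ := Metric.isOpen_iff.1 hCo _ h
    have : sInf C - ε / 2 ∈ C := hball (by simp [abs_of_pos hε]; linarith)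
    linarith [csInf_le hb this]
  have hsup : sSup C ∉ C := fun h => by
    obtain ⟨ε, hε, hball⟩ := Metric.isOpen_iff.1 hCo _ h
    have : sSup C + ε / 2 ∈ C := hball (by simp [abs_of_pos hε]; linarith)
    linarith [le_csSup ha this]
  have heq : C = Ioo (sInf C) (sSup C) := by
    refine subset_antisymm (fun y hy => ⟨?_, ?_⟩) (hCc.Ioo_csInf_csSup_subset hb ha)
    · exact lt_of_le_of_ne (csInf_le hb hy) fun h => hinf (h ▸ hy)
    · exact lt_of_le_of_ne (le_csSup ha hy) fun h => hsup (h ▸ hy)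
  refine ⟨sInf C, sSup C, ?_, fun h => hinf (hmem h (csInf_mem_closure ⟨x, hxC⟩ hb)),
    fun h => hsup (hmem h (csSup_mem_closure ⟨x, hxC⟩ ha)), heq⟩
  rw [heq] at hxC
  exact hxC.1.trans hxC.2

/-- One-dimensional Hardy inequality with a remainder `e` controlling the values of `f`,
on an arbitrary open set. -/
theorem exists_hardy_remainder {f : ℝ → ℝ} {q : ℝ} {O : Set ℝ} (hf : ContDiff ℝ 1 f)
    (hfc : HasCompactSupport f) (hO : IsOpen O) (hfO : tsupport f ⊆ O) (hq : 2 ≤ q) :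
    ∃ e : ENNReal, (∫⁻ x, ENNReal.ofReal (f x ^ 2 / 4) * ENNReal.ofReal (lineDist O x ^ 2)⁻¹) + e ≤
        ∫⁻ x, ENNReal.ofReal (deriv f x ^ 2) ∧
      ∀ t, ENNReal.ofReal (|f t| ^ (q + 2)) ≤
        ENNReal.ofReal (lineConst (q / 2 + 1) ^ 2) * e * ∫⁻ x, ENNReal.ofReal (|f x| ^ q) := by
  obtain ⟨r, hr⟩ := hfc.isCompact.isBounded.subset_ball (0 : ℝ)
  set P : Set ℝ := O ∩ ball 0 r with hP
  have hPo : IsOpen P := hO.inter isOpen_ball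
  have hPb : Bornology.IsBounded P := isBounded_ball.subset inter_subset_right
  have hfP : tsupport f ⊆ P := subset_inter hfO hr
  have hzero {x : ℝ} (hx : x ∉ P) : ∀ᶠ y in nhds x, f y = 0 :=
    notMem_tsupport_iff_eventuallyEq.1 fun h => hx (hfP h)
  set S : Set (Set ℝ) := connectedComponentIn P '' P
  have hSd : S.PairwiseDisjoint id := by
    rintro _ ⟨x, hx, rfl⟩ _ ⟨y, hy, rfl⟩ hne
    refine Set.disjoint_left.2 fun z hz1 hz2 => hne ?_
    exact (connectedComponentIn_eq hz1).trans (connectedComponentIn_eq hz2).symm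
  have hSo : ∀ C ∈ S, IsOpen C := by
    rintro _ ⟨x, hx, rfl⟩
    exact hPo.connectedComponentIn
  have hScount : S.Countable := hSd.countable_of_isOpen hSo (by
    rintro _ ⟨x, hx, rfl⟩
    exact ⟨x, mem_connectedComponentIn hx⟩)
  have hSU : P = ⋃ C : S, (C : Set ℝ) := by
    ext x
    simp only [mem_iUnion, Subtype.exists, exists_prop]
    refine ⟨fun hx => ⟨_, ⟨x, hx, rfl⟩, mem_connectedComponentIn hx⟩, ?_⟩
    rintro ⟨_, ⟨y, hy, rfl⟩, h⟩
    exact connectedComponentIn_subset _ _ h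
  have : Countable S := hScount.to_subtype
  have hloc (C : S) : ∃ e : ENNReal,
      (∫⁻ x in C, ENNReal.ofReal (f x ^ 2 / 4) * ENNReal.ofReal (lineDist O x ^ 2)⁻¹) + e ≤
        ∫⁻ x in C, ENNReal.ofReal (deriv f x ^ 2) ∧
      ∀ t ∈ (C : Set ℝ), ENNReal.ofReal (|f t| ^ (q + 2)) ≤
        ENNReal.ofReal (lineConst (q / 2 + 1) ^ 2) * e * ∫⁻ x, ENNReal.ofReal (|f x| ^ q) := by
    obtain ⟨_, x, hx, rfl⟩ := C
    obtain ⟨a, b, hab, ha, hb, heq⟩ := connectedComponentIn_eq_Ioo hPo hPb.bddBelow hPb.bddAbove hx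
    have hsub : Ioo a b ⊆ O := by
      rw [← heq]
      exact (connectedComponentIn_subset _ _).trans inter_subset_left
    simp only [heq]
    exact exists_hardy_remainder_Ioo hf (hzero ha) (hzero hb) hq hab _ fun x hx =>
      ENNReal.ofReal_le_ofReal (inv_lineDist_sq_le hsub hx)
  choose e he ht using hloc
  have conv (g : ℝ → ENNReal) : ∫⁻ x in P, g x = ∑' C : S, ∫⁻ x in C, g x := by
    have h := lintegral_iUnion (μ := volume) (s := fun C : S => (C : Set ℝ))
      (fun C => (hSo C C.2).measurableSet)
      (fun C D hCD => hSd C.2 D.2 (Subtype.coe_ne_coe.2 hCD)) g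
    rwa [← hSU] at h
  refine ⟨∑' C, e C, ?_, fun t => ?_⟩
  · have h1 : (∫⁻ x, ENNReal.ofReal (f x ^ 2 / 4) * ENNReal.ofReal (lineDist O x ^ 2)⁻¹) =
        ∫⁻ x in P, ENNReal.ofReal (f x ^ 2 / 4) * ENNReal.ofReal (lineDist O x ^ 2)⁻¹ := by
      refine (setLIntegral_eq_of_support_subset fun x hx => ?_).symm
      by_contra h
      have : f x = 0 := (hzero h).self_of_nhds
      simp [this] at hx
    rw [h1, conv, ← ENNReal.tsum_add]
    refine (ENNReal.tsum_le_tsum he).trans ?_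
    rw [← conv]
    exact setLIntegral_le_lintegral _ _
  · by_cases htP : t ∈ P
    · have htC : connectedComponentIn P t ∈ S := ⟨t, htP, rfl⟩
      refine (ht ⟨_, htC⟩ t (mem_connectedComponentIn htP)).trans ?_
      gcongr
      exact ENNReal.le_tsum _
    · rw [(hzero htP).self_of_nhds, abs_zero, Real.zero_rpow (by linarith)]
      simp

theorem Measurable.lintegral_update {ι : Type*} [DecidableEq ι]
    {F : (ι → ℝ) → ENNReal} (hF : Measurable F) (i : ι) :
    Measurable fun x => ∫⁻ s, F (Function.update x i s) := by
  have := hF.lmarginal (fun _ : ι => (volume : Measure ℝ)) (s := {i})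
  rwa [lmarginal_singleton] at this

/-- If the line integrals of `A` in direction `i` dominate those of `B`, with an excess controlling
`U`, then the excess can be redistributed along the lines proportionally to `U`. -/
theorem exists_density_of_line_bound {ι : Type*} [Fintype ι] [DecidableEq ι]
    {U A B : (ι → ℝ) → ENNReal} {K : ENNReal} {r : ℝ}
    (i : ι) (hU : Measurable U) (hA : Measurable A) (hB : Measurable B)
    (hUf : ∀ x, ∫⁻ s, U (Function.update x i s) ≠ ⊤)
    (hBf : ∀ x, ∫⁻ s, B (Function.update x i s) ≠ ⊤)
    (h : ∀ x, ∃ e, (∫⁻ s, B (Function.update x i s)) + e ≤ ∫⁻ s, A (Function.update x i s) ∧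
      U x ^ r ≤ K * e * ∫⁻ s, U (Function.update x i s)) :
    ∃ p : (ι → ℝ) → ENNReal, Measurable p ∧ (∫⁻ x, p x) + ∫⁻ x, B x ≤ ∫⁻ x, A x ∧
      ∀ x, U x ^ r ≤ K * (∫⁻ s, (U (Function.update x i s) * p (Function.update x i s))
        ^ (1 / 2 : ℝ)) ^ 2 := by
  set u : (ι → ℝ) → ENNReal := fun x => ∫⁻ s, U (Function.update x i s) with hu
  set a : (ι → ℝ) → ENNReal := fun x => ∫⁻ s, A (Function.update x i s) with ha
  set b : (ι → ℝ) → ENNReal := fun x => ∫⁻ s, B (Function.update x i s) with hb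
  have hum : Measurable u := hU.lintegral_update i
  have ham : Measurable a := hA.lintegral_update i
  have hbm : Measurable b := hB.lintegral_update i
  have hba (x) : b x ≤ a x := by
    obtain ⟨e, he, -⟩ := h x
    exact le_self_add.trans he
  have uu (x s) : u (Function.update x i s) = u x := by simp [hu]
  have aa (x s) : a (Function.update x i s) = a x := by simp [ha]
  have bb (x s) : b (Function.update x i s) = b x := by simp [hb]
  have hline (x : ι → ℝ) : Measurable fun s => U (Function.update x i s) :=
    hU.comp (measurable_update x)
  have hlineB (x : ι → ℝ) : Measurable fun s => B (Function.update x i s) :=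
    hB.comp (measurable_update x)
  have hpm : Measurable fun x => U x * ((a x - b x) / u x) := hU.mul ((ham.sub hbm).div hum)
  refine ⟨fun x => U x * ((a x - b x) / u x), hpm, ?_, fun x => ?_⟩
  · rw [← lintegral_add_right _ hB]
    refine lintegral_le_of_lmarginal_le (μ := fun _ => volume) {i} (hpm.add hB) hA ?_
    intro x
    simp only [lmarginal_singleton, uu, aa, bb]
    rw [lintegral_add_right _ (hlineB x), lintegral_mul_const _ (hline x)]
    calc u x * ((a x - b x) / u x) + b x ≤ (a x - b x) + b x := by
          gcongr; exact ENNReal.mul_div_le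
      _ = a x := tsub_add_cancel_of_le (hba x)
  · obtain ⟨e, he, hle⟩ := h x
    have hle' : U x ^ r ≤ K * (a x - b x) * u x := by
      refine hle.trans ?_
      gcongr
      exact ENNReal.le_sub_of_add_le_left (hBf x) he
    rcases eq_or_ne (u x) 0 with h0 | h0
    · rw [h0, mul_zero] at hle'
      exact hle'.trans zero_le
    simp only [uu, aa, bb]
    have e1 (s) : (U (Function.update x i s) * (U (Function.update x i s) *
        ((a x - b x) / u x))) ^ (1 / 2 : ℝ)
        = U (Function.update x i s) * ((a x - b x) / u x) ^ (1 / 2 : ℝ) := by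
      rw [← mul_assoc, ← sq, ENNReal.mul_rpow_of_nonneg _ _ (by norm_num), ← ENNReal.rpow_natCast,
        ← ENNReal.rpow_mul]
      norm_num
    simp only [e1]
    rw [lintegral_mul_const _ (hline x), mul_pow, ← ENNReal.rpow_natCast (_ ^ (1 / 2 : ℝ)),
      ← ENNReal.rpow_mul]
    norm_num
    change _ ≤ K * (u x ^ 2 * _)
    refine hle'.trans (le_of_eq ?_)
    rw [sq, mul_assoc (u x), ENNReal.mul_div_cancel h0 (hUf x)]
    ring

/-- A Gagliardo–Nirenberg type summation: inequalities along all lines parallel to the coordinate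
axes imply a Sobolev inequality. -/
theorem rpow_lintegral_le_of_line_bounds {N : ℕ} (hN : 3 ≤ N) {U : (Fin N → ℝ) → ENNReal}
    {A B : Fin N → (Fin N → ℝ) → ENNReal} {K : ENNReal}
    (hU : Measurable U) (hA : ∀ i, Measurable (A i)) (hB : ∀ i, Measurable (B i))
    (hf : ∫⁻ x, U x ≠ ⊤)
    (hUf : ∀ i x, ∫⁻ s, U (Function.update x i s) ≠ ⊤)
    (hBf : ∀ i x, ∫⁻ s, B i (Function.update x i s) ≠ ⊤)
    (h : ∀ i x, ∃ e, (∫⁻ s, B i (Function.update x i s)) + e ≤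
        ∫⁻ s, A i (Function.update x i s) ∧
      U x ^ (2 * (N - 1) / N : ℝ) ≤ K * e * ∫⁻ s, U (Function.update x i s)) :
    (∫⁻ x, U x) ^ ((N - 2) / N : ℝ) + K * N ^ 2 * ∑ i, ∫⁻ x, B i x ≤
      K * N ^ 2 * ∑ i, ∫⁻ x, A i x := by
  have hN' : (3 : ℝ) ≤ N := by exact_mod_cast hN
  have hN1 : (0 : ℝ) < N - 1 := by linarith
  have hN0 : (0 : ℝ) < N := by linarith
  choose p hpm hp1 hp2 using fun i =>
    exists_density_of_line_bound i hU (hA i) (hB i) (hUf i) (hBf i) (h i)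
  set H := ∫⁻ x, U x with hH
  set P := ∑ i, ∫⁻ x, p i x with hP
  have hPA : P + ∑ i, ∫⁻ x, B i x ≤ ∑ i, ∫⁻ x, A i x := by
    rw [hP, ← Finset.sum_add_distrib]
    exact Finset.sum_le_sum fun i _ => hp1 i
  suffices hmain : H ^ ((N - 2) / N : ℝ) ≤ K * N ^ 2 * P by
    calc _ ≤ K * N ^ 2 * P + K * N ^ 2 * ∑ i, ∫⁻ x, B i x := by gcongr
      _ = K * N ^ 2 * (P + ∑ i, ∫⁻ x, B i x) := by ring
      _ ≤ _ := by gcongr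
  set G : Fin N → (Fin N → ℝ) → ENNReal := fun i x => (U x * p i x) ^ (1 / 2 : ℝ) with hG
  have hGm (i) : Measurable (G i) := (hU.mul (hpm i)).pow_const _
  set F : (Fin N → ℝ) → ENNReal := fun x => ∑ i, G i x with hF
  have hFm : Measurable F := Finset.measurable_fun_sum _ fun i _ => hGm i
  have hGle (i) : ∫⁻ x, G i x ≤ (H * P) ^ (1 / 2 : ℝ) := by
    have hconj : (2 : ℝ).HolderConjugate 2 := Real.HolderConjugate.two_two
    have h1 := ENNReal.lintegral_mul_le_Lp_mul_Lq volume hconj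
      (f := fun x => U x ^ (1 / 2 : ℝ)) (g := fun x => p i x ^ (1 / 2 : ℝ))
      (hU.pow_const _).aemeasurable ((hpm i).pow_const _).aemeasurable
    have e2 (y : ENNReal) : (y ^ (1 / 2 : ℝ)) ^ (2 : ℝ) = y := by
      rw [← ENNReal.rpow_mul]; norm_num
    simp only [Pi.mul_apply, e2] at h1
    calc ∫⁻ x, G i x = ∫⁻ x, U x ^ (1 / 2 : ℝ) * p i x ^ (1 / 2 : ℝ) := by
          simp only [hG, ENNReal.mul_rpow_of_nonneg _ _ (by norm_num : (0 : ℝ) ≤ 1 / 2)]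
      _ ≤ _ := h1
      _ = (H * ∫⁻ x, p i x) ^ (1 / 2 : ℝ) := by
          rw [ENNReal.mul_rpow_of_nonneg _ _ (by norm_num : (0 : ℝ) ≤ 1 / 2)]
      _ ≤ _ := by
          gcongr
          exact Finset.single_le_sum (f := fun i => ∫⁻ x, p i x) (fun _ _ => zero_le)
            (Finset.mem_univ i)
  have hFle : ∫⁻ x, F x ≤ N * (H * P) ^ (1 / 2 : ℝ) := by
    rw [lintegral_finsetSum _ fun i _ => hGm i]
    refine (Finset.sum_le_sum fun i _ => hGle i).trans ?_
    simp
  have hpt (x) (i) : U x ^ (1 / N : ℝ) ≤ K ^ (1 / (2 * (N - 1)) : ℝ) *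
      (∫⁻ s, F (Function.update x i s)) ^ (1 / (N - 1) : ℝ) := by
    have h1 : U x ^ (2 * (N - 1) / N : ℝ) ≤ K * (∫⁻ s, F (Function.update x i s)) ^ 2 := by
      refine (hp2 i x).trans ?_
      gcongr with s
      exact Finset.single_le_sum (f := fun j => G j (Function.update x i s)) (fun _ _ => zero_le)
        (Finset.mem_univ i)
    have h2 := ENNReal.rpow_le_rpow h1 (by positivity : (0 : ℝ) ≤ 1 / (2 * (N - 1)))
    rw [← ENNReal.rpow_mul, ENNReal.mul_rpow_of_nonneg _ _ (by positivity),
      ← ENNReal.rpow_natCast, ← ENNReal.rpow_mul] at h2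
    convert h2 using 2
    · field_simp
    · congr 1
      push_cast
      field_simp
  have hconj : Real.HolderConjugate (Fintype.card (Fin N)) (N / (N - 1)) := by
    rw [Fintype.card_fin]
    exact Real.HolderConjugate.conjExponent (by linarith)
  have hLW := lintegral_prod_lintegral_pow_le (fun _ : Fin N => (volume : Measure ℝ)) hconj hFm
  simp only [Fintype.card_fin] at hLW
  have hmain : H ≤ (K * N ^ 2 * P * H) ^ (N / (2 * (N - 1)) : ℝ) := by
    calc H ≤ ∫⁻ x, ∏ i : Fin N, (K ^ (1 / (2 * (N - 1)) : ℝ) *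
          (∫⁻ s, F (Function.update x i s)) ^ (1 / (N - 1) : ℝ)) := by
          refine lintegral_mono fun x => ?_
          refine le_trans (le_of_eq ?_) (Finset.prod_le_prod' fun i _ => hpt x i)
          rw [Finset.prod_const, Finset.card_univ, Fintype.card_fin, ← ENNReal.rpow_natCast,
            ← ENNReal.rpow_mul, one_div_mul_cancel hN0.ne', ENNReal.rpow_one]
      _ = K ^ (N / (2 * (N - 1)) : ℝ) * ∫⁻ x, ∏ i : Fin N,
          (∫⁻ s, F (Function.update x i s)) ^ (1 / (N - 1) : ℝ) := by
          rw [← lintegral_const_mul]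
          · simp only [Finset.prod_mul_distrib, Finset.prod_const, Finset.card_univ,
              Fintype.card_fin]
            rw [← ENNReal.rpow_natCast, ← ENNReal.rpow_mul, one_div_mul_eq_div]
          · exact Finset.measurable_fun_prod _ fun i _ => (hFm.lintegral_update i).pow_const _
      _ ≤ K ^ (N / (2 * (N - 1)) : ℝ) * (N * (H * P) ^ (1 / 2 : ℝ)) ^ (N / (N - 1) : ℝ) := by
          gcongr
          exact hLW.trans (ENNReal.rpow_le_rpow hFle (by positivity))
      _ = _ := by
          have : (N / (N - 1) : ℝ) = 2 * (N / (2 * (N - 1))) := by field_simp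
          rw [this, ENNReal.rpow_mul, ← ENNReal.mul_rpow_of_nonneg _ _ (by positivity),
            ENNReal.mul_rpow_of_nonneg _ _ (by norm_num : (0 : ℝ) ≤ 2), ← ENNReal.rpow_mul]
          norm_num
          congr 1
          ring
  rcases eq_or_ne H 0 with h0 | h0
  · rw [h0, ENNReal.zero_rpow_of_pos (by apply div_pos <;> linarith)]
    exact zero_le
  have h3 := ENNReal.rpow_le_rpow hmain (by positivity : (0 : ℝ) ≤ 2 * (N - 1) / N)
  rw [← ENNReal.rpow_mul, show (N / (2 * (N - 1)) * (2 * (N - 1) / N) : ℝ) = 1 by field_simp,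
    ENNReal.rpow_one, show (2 * (N - 1) / N : ℝ) = (N - 2) / N + 1 by field_simp; ring,
    ENNReal.rpow_add _ _ h0 hf, ENNReal.rpow_one] at h3
  exact (ENNReal.mul_le_mul_iff_left h0 hf).1 h3

theorem dirDist_nonneg {N : ℕ} (Ω : Set (EuclideanSpace ℝ (Fin N)))
    (x e : EuclideanSpace ℝ (Fin N)) : 0 ≤ dirDist Ω x e := by
  apply Real.sInf_nonneg
  rintro r ⟨t, rfl, -⟩
  exact abs_nonneg t

theorem isClosed_exists_abs_le_mem_compl {N : ℕ} {Ω : Set (EuclideanSpace ℝ (Fin N))}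
    (hΩ : IsOpen Ω) (ρ : ℝ) :
    IsClosed {p : EuclideanSpace ℝ (Fin N) × EuclideanSpace ℝ (Fin N) |
      ∃ t : ℝ, |t| ≤ ρ ∧ p.1 + t • p.2 ∈ Ωᶜ} := by
  have hcl : IsClosed {z : Icc (-ρ) ρ × EuclideanSpace ℝ (Fin N) × EuclideanSpace ℝ (Fin N) |
      z.2.1 + (z.1 : ℝ) • z.2.2 ∈ Ωᶜ} :=
    hΩ.isClosed_compl.preimage (by fun_prop)
  convert isClosedMap_snd_of_compactSpace _ hcl using 1
  ext p
  simp only [mem_ofPred_eq, mem_image, Prod.exists, Subtype.exists, abs_le]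
  constructor
  · rintro ⟨t, ht, hp⟩
    exact ⟨t, ht, p.1, p.2, hp, rfl⟩
  · rintro ⟨t, ht, a, b, hp, rfl⟩
    exact ⟨t, ht, hp⟩

theorem measurable_dirDist {N : ℕ} {Ω : Set (EuclideanSpace ℝ (Fin N))} (hΩ : IsOpen Ω) :
    Measurable fun p : EuclideanSpace ℝ (Fin N) × EuclideanSpace ℝ (Fin N) =>
      dirDist Ω p.1 p.2 := by
  set Z : ℝ → Set (EuclideanSpace ℝ (Fin N) × EuclideanSpace ℝ (Fin N)) := fun ρ =>
    {p | ∃ t : ℝ, |t| ≤ ρ ∧ p.1 + t • p.2 ∈ Ωᶜ} with hZ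
  have hZm : ∀ ρ, MeasurableSet (Z ρ) := fun ρ =>
    (isClosed_exists_abs_le_mem_compl hΩ ρ).measurableSet
  refine measurable_of_Iio fun r => ?_
  rcases le_or_gt r 0 with hr | hr
  · convert MeasurableSet.empty
    ext p
    simpa using hr.trans (dirDist_nonneg Ω p.1 p.2)
  have key : (fun p : EuclideanSpace ℝ (Fin N) × EuclideanSpace ℝ (Fin N) =>
      dirDist Ω p.1 p.2) ⁻¹' Iio r =
      (⋃ n : ℕ, Z n)ᶜ ∪ ⋃ n : ℕ, Z (r - 1 / (n + 1)) := by
    ext p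
    simp only [mem_preimage, mem_Iio, mem_union, mem_compl_iff, mem_iUnion, not_exists]
    have hbdd : BddBelow {r : ℝ | ∃ t : ℝ, r = |t| ∧ p.1 + t • p.2 ∈ Ωᶜ} :=
      ⟨0, by rintro _ ⟨t, rfl, -⟩; exact abs_nonneg t⟩
    by_cases hne : {r : ℝ | ∃ t : ℝ, r = |t| ∧ p.1 + t • p.2 ∈ Ωᶜ}.Nonempty
    · obtain ⟨_, t, rfl, ht⟩ := hne
      have h1 : ¬ ∀ n : ℕ, p ∉ Z n := by
        push Not
        obtain ⟨n, hn⟩ := exists_nat_ge |t|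
        exact ⟨n, t, hn, ht⟩
      rw [dirDist, csInf_lt_iff hbdd ⟨_, t, rfl, ht⟩]
      simp only [h1, false_or]
      constructor
      · rintro ⟨_, ⟨s, rfl, hs⟩, hsr⟩
        obtain ⟨n, hn⟩ := exists_nat_one_div_lt (sub_pos.2 hsr)
        exact ⟨n, s, by linarith, hs⟩
      · rintro ⟨n, s, hs, hs'⟩
        refine ⟨_, ⟨s, rfl, hs'⟩, ?_⟩
        have : (0 : ℝ) < 1 / (n + 1) := by positivity
        linarith
    · have h1 : ∀ ρ, p ∉ Z ρ := by
        rintro ρ ⟨t, -, ht⟩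
        exact hne ⟨_, t, rfl, ht⟩
      simp only [h1, not_false_eq_true, implies_true, exists_false, or_false, iff_true]
      rw [dirDist, not_nonempty_iff_eq_empty.1 hne, Real.sInf_empty]
      exact hr
  rw [key]
  exact (MeasurableSet.iUnion fun n => hZm _).compl.union (MeasurableSet.iUnion fun n => hZm _)

theorem inv_dirDist_sq_le {N : ℕ} {Ω : Set (EuclideanSpace ℝ (Fin N))}
    {x e : EuclideanSpace ℝ (Fin N)} {δ : ℝ} (hδ : 0 < δ) (he : ‖e‖ = 1)
    (hx : ball x δ ⊆ Ω) : (dirDist Ω x e ^ 2)⁻¹ ≤ (δ ^ 2)⁻¹ := by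
  rw [dirDist]
  rcases eq_empty_or_nonempty {r : ℝ | ∃ t : ℝ, r = |t| ∧ x + t • e ∈ Ωᶜ} with h | h
  · rw [h, Real.sInf_empty]
    simp; positivity
  · have : δ ≤ sInf {r : ℝ | ∃ t : ℝ, r = |t| ∧ x + t • e ∈ Ωᶜ} := by
      apply le_csInf h
      rintro _ ⟨t, rfl, ht⟩
      by_contra hlt
      exact ht (hx (by simpa [mem_ball, dist_eq_norm, norm_smul, he] using hlt))
    gcongr

theorem exists_hardy_remainder_line {N : ℕ} {Ω : Set (EuclideanSpace ℝ (Fin N))} (hΩ : IsOpen Ω)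
    {u : EuclideanSpace ℝ (Fin N) → ℝ} (hu : ContDiff ℝ 1 u) (hc : HasCompactSupport u)
    (hs : tsupport u ⊆ Ω) {q : ℝ} (hq : 2 ≤ q) (x : EuclideanSpace ℝ (Fin N))
    {v : EuclideanSpace ℝ (Fin N)} (hv : ‖v‖ = 1) :
    ∃ e : ENNReal, (∫⁻ t : ℝ, ENNReal.ofReal (u (x + t • v) ^ 2 / 4) *
        ENNReal.ofReal (dirDist Ω (x + t • v) v ^ 2)⁻¹) + e ≤
        ∫⁻ t : ℝ, ENNReal.ofReal (fderiv ℝ u (x + t • v) v ^ 2) ∧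
      (∀ t : ℝ, ENNReal.ofReal (|u (x + t • v)| ^ (q + 2)) ≤
        ENNReal.ofReal (lineConst (q / 2 + 1) ^ 2) * e *
          ∫⁻ t : ℝ, ENNReal.ofReal (|u (x + t • v)| ^ q)) ∧
      (∫⁻ t : ℝ, ENNReal.ofReal (fderiv ℝ u (x + t • v) v ^ 2)) ≠ ⊤ ∧
      (∫⁻ t : ℝ, ENNReal.ofReal (|u (x + t • v)| ^ q)) ≠ ⊤ := by
  have hiso : Isometry fun t : ℝ => x + t • v := by
    refine Isometry.of_dist_eq fun a b => ?_
    simp [dist_eq_norm, ← sub_smul, norm_smul, hv]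
  have hcont : Continuous fun t : ℝ => x + t • v := hiso.continuous
  have hcd : ContDiff ℝ 1 fun t : ℝ => x + t • v := by fun_prop
  have hfc : HasCompactSupport fun t : ℝ => u (x + t • v) :=
    hc.comp_isClosedEmbedding hiso.isClosedEmbedding
  have hdc : HasCompactSupport fun t : ℝ => fderiv ℝ u (x + t • v) :=
    (hc.fderiv ℝ).comp_isClosedEmbedding hiso.isClosedEmbedding
  have hder : ∀ t : ℝ, deriv (fun t : ℝ => u (x + t • v)) t = fderiv ℝ u (x + t • v) v := by
    intro t
    have h1 : HasDerivAt (fun t : ℝ => x + t • v) v t := by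
      simpa using ((hasDerivAt_id t).smul_const v).const_add x
    exact ((hu.differentiable one_ne_zero _).hasFDerivAt.comp_hasDerivAt t h1).deriv
  have hdist : ∀ t : ℝ, lineDist {s : ℝ | x + s • v ∈ Ω} t = dirDist Ω (x + t • v) v := by
    intro t
    simp only [lineDist, dirDist, mem_compl_iff, mem_ofPred_eq, add_smul, add_assoc]
  obtain ⟨e, he1, he2⟩ := exists_hardy_remainder (f := fun t : ℝ => u (x + t • v))
    (O := {s : ℝ | x + s • v ∈ Ω}) (hu.comp hcd) hfc (hΩ.preimage hcont)
    ((tsupport_comp_subset_preimage u hcont).trans fun t ht => hs ht) hq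
  simp only [hder, hdist] at he1
  refine ⟨e, he1, he2, ?_, ?_⟩
  · refine (Continuous.integrable_of_hasCompactSupport (f := fun t : ℝ =>
      fderiv ℝ u (x + t • v) v ^ 2) ?_ ?_).lintegral_lt_top.ne
    · have := hu.continuous_fderiv one_ne_zero
      fun_prop
    · exact hdc.comp_left (g := fun l : EuclideanSpace ℝ (Fin N) →L[ℝ] ℝ => l v ^ 2) (by simp)
  · refine (Continuous.integrable_of_hasCompactSupport (f := fun t : ℝ =>
      |u (x + t • v)| ^ q) ?_ ?_).lintegral_lt_top.ne
    · have := hu.continuous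
      exact (by fun_prop : Continuous fun t : ℝ => |u (x + t • v)|).rpow_const
        fun t => Or.inr (by linarith)
    · exact hfc.comp_left (g := fun r : ℝ => |r| ^ q)
        (by simp [Real.zero_rpow (by linarith : q ≠ 0)])

theorem OrthonormalBasis.sum_sq_apply_eq_norm_sq {ι E : Type*} [Fintype ι] [NormedAddCommGroup E]
    [InnerProductSpace ℝ E] [CompleteSpace E] (b : OrthonormalBasis ι ℝ E) (l : E →L[ℝ] ℝ) :
    ∑ i, l (b i) ^ 2 = ‖l‖ ^ 2 := by
  obtain ⟨w, rfl⟩ := (InnerProductSpace.toDual ℝ E).surjective l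
  simp only [InnerProductSpace.toDual_apply_apply, LinearIsometryEquiv.norm_map]
  simpa using b.sum_sq_norm_inner_left w

theorem measurable_hardy_density {N : ℕ} {Ω : Set (EuclideanSpace ℝ (Fin N))} (hΩ : IsOpen Ω)
    {u : EuclideanSpace ℝ (Fin N) → ℝ} (hu : Measurable u) :
    Measurable fun p : EuclideanSpace ℝ (Fin N) × EuclideanSpace ℝ (Fin N) =>
      ENNReal.ofReal (u p.1 ^ 2 / 4) * ENNReal.ofReal (dirDist Ω p.1 p.2 ^ 2)⁻¹ := by
  have h1 := measurable_dirDist hΩ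
  exact (((hu.comp measurable_fst).pow_const 2).div_const 4).ennreal_ofReal.mul
    (h1.pow_const 2).inv.ennreal_ofReal

theorem OrthonormalBasis.repr_symm_toLp_update {ι E : Type*} [Fintype ι] [DecidableEq ι]
    [NormedAddCommGroup E] [InnerProductSpace ℝ E] (b : OrthonormalBasis ι ℝ E) (i : ι)
    (y : ι → ℝ) (s : ℝ) :
    b.repr.symm (WithLp.toLp 2 (Function.update y i s)) =
      b.repr.symm (WithLp.toLp 2 (Function.update y i 0)) + s • b i := by
  rw [← b.repr_symm_single, ← map_smul, ← map_add]
  congr 1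
  ext j
  by_cases h : j = i
  · subst h; simp
  · simp [h]

/-- The sharp directional Hardy inequalities along an orthonormal frame, summed, with a
Sobolev remainder term. -/
theorem rpow_lintegral_add_hardy_frame_le {N : ℕ} (hN : 3 ≤ N)
    {Ω : Set (EuclideanSpace ℝ (Fin N))} (hΩ : IsOpen Ω)
    {u : EuclideanSpace ℝ (Fin N) → ℝ} (hu : ContDiff ℝ 1 u) (hc : HasCompactSupport u)
    (hs : tsupport u ⊆ Ω) {q : ℝ} (hq : q = 2 * N / (N - 2))
    (b : OrthonormalBasis (Fin N) ℝ (EuclideanSpace ℝ (Fin N))) :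
    (∫⁻ x, ENNReal.ofReal (|u x| ^ q)) ^ ((N - 2) / N : ℝ) +
      ENNReal.ofReal (lineConst (q / 2 + 1) ^ 2) * N ^ 2 *
        ∑ i, ∫⁻ x, ENNReal.ofReal (u x ^ 2 / 4) *
          ENNReal.ofReal (dirDist Ω x (b i) ^ 2)⁻¹ ≤
    ENNReal.ofReal (lineConst (q / 2 + 1) ^ 2) * N ^ 2 *
      ∫⁻ x, ENNReal.ofReal (‖fderiv ℝ u x‖ ^ 2) := by
  have hN' : (3 : ℝ) ≤ N := by exact_mod_cast hN
  have hN2 : (0 : ℝ) < N - 2 := by linarith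
  have hN1 : (0 : ℝ) < N - 1 := by linarith
  have hq2 : 2 ≤ q := by
    rw [hq, le_div_iff₀ hN2]; linarith
  have hu0 := hu.continuous
  have hu1 := hu.continuous_fderiv one_ne_zero
  have huq : Continuous fun x => |u x| ^ q :=
    hu0.abs.rpow_const fun t => Or.inr (by linarith)
  obtain ⟨φ, hφm, hφu⟩ : ∃ φ : (Fin N → ℝ) → EuclideanSpace ℝ (Fin N), MeasurePreserving φ ∧
      ∀ i y, ∃ x₀, ∀ s, φ (Function.update y i s) = x₀ + s • b i :=
    ⟨_, b.measurePreserving_repr_symm.comp (PiLp.volume_preserving_toLp (Fin N)),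
      fun i y => ⟨_, b.repr_symm_toLp_update i y⟩⟩
  have hφc : Measurable φ := hφm.measurable
  have hnorm : ∀ i, ‖b i‖ = 1 := fun i => by simp
  have hBm : ∀ i, Measurable fun x => ENNReal.ofReal (u x ^ 2 / 4) *
      ENNReal.ofReal (dirDist Ω x (b i) ^ 2)⁻¹ := by
    intro i
    exact (measurable_hardy_density hΩ hu0.measurable).of_uncurry_right (f := fun x v =>
      ENNReal.ofReal (u x ^ 2 / 4) * ENNReal.ofReal (dirDist Ω x v ^ 2)⁻¹)
  have hAm : ∀ i, Measurable fun x =>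
      ENNReal.ofReal (fderiv ℝ u x (b i) ^ 2) := by
    intro i
    exact (by fun_prop : Continuous fun x =>
      fderiv ℝ u x (b i) ^ 2).measurable.ennreal_ofReal
  have hUm : Measurable fun x => ENNReal.ofReal (|u x| ^ q) := huq.measurable.ennreal_ofReal
  have key := rpow_lintegral_le_of_line_bounds hN
    (U := fun y => ENNReal.ofReal (|u (φ y)| ^ q))
    (A := fun i y => ENNReal.ofReal (fderiv ℝ u (φ y) (b i) ^ 2))
    (B := fun i y => ENNReal.ofReal (u (φ y) ^ 2 / 4) *
      ENNReal.ofReal (dirDist Ω (φ y) (b i) ^ 2)⁻¹)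
    (K := ENNReal.ofReal (lineConst (q / 2 + 1) ^ 2))
    (hUm.comp hφc) (fun i => (hAm i).comp hφc) (fun i => (hBm i).comp hφc)
    ?_ ?_ ?_ ?_
  · rw [hφm.lintegral_comp hUm] at key
    have hA : ∀ i, ∫⁻ y, ENNReal.ofReal (fderiv ℝ u (φ y) (b i) ^ 2) =
        ∫⁻ x, ENNReal.ofReal (fderiv ℝ u x (b i) ^ 2) :=
      fun i => hφm.lintegral_comp (hAm i)
    have hB : ∀ i, ∫⁻ y, ENNReal.ofReal (u (φ y) ^ 2 / 4) *
        ENNReal.ofReal (dirDist Ω (φ y) (b i) ^ 2)⁻¹ =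
        ∫⁻ x, ENNReal.ofReal (u x ^ 2 / 4) *
          ENNReal.ofReal (dirDist Ω x (b i) ^ 2)⁻¹ :=
      fun i => hφm.lintegral_comp (hBm i)
    simp only [hA, hB] at key
    rw [← lintegral_finsetSum _ fun i _ => hAm i] at key
    have hsum : ∀ x, ∑ i, ENNReal.ofReal (fderiv ℝ u x (b i) ^ 2) =
        ENNReal.ofReal (‖fderiv ℝ u x‖ ^ 2) := fun x => by
      rw [← ENNReal.ofReal_sum_of_nonneg fun i _ => sq_nonneg _, b.sum_sq_apply_eq_norm_sq]
    simpa only [hsum] using key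
  · rw [hφm.lintegral_comp hUm]
    exact (huq.integrable_of_hasCompactSupport (hc.comp_left (g := fun r : ℝ => |r| ^ q)
      (by simp [Real.zero_rpow (by linarith : q ≠ 0)]))).lintegral_lt_top.ne
  · intro i y
    obtain ⟨x₀, hx₀⟩ := hφu i y
    obtain ⟨e, -, -, -, h⟩ := exists_hardy_remainder_line hΩ hu hc hs hq2 x₀ (hnorm i)
    simpa only [hx₀] using h
  · intro i y
    obtain ⟨x₀, hx₀⟩ := hφu i y
    obtain ⟨e, h1, -, h2, -⟩ := exists_hardy_remainder_line hΩ hu hc hs hq2 x₀ (hnorm i)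
    simp only [hx₀]
    exact ne_top_of_le_ne_top h2 (le_self_add.trans h1)
  · intro i y
    obtain ⟨x₀, hx₀⟩ := hφu i y
    obtain ⟨e, h1, h2, -, -⟩ := exists_hardy_remainder_line hΩ hu hc hs hq2 x₀ (hnorm i)
    refine ⟨e, by simpa only [hx₀] using h1, ?_⟩
    have h3 := h2 (y i)
    rw [← hx₀, Function.update_eq_self] at h3
    simp only [hx₀]
    rw [ENNReal.ofReal_rpow_of_nonneg (by positivity) (by positivity),
      ← Real.rpow_mul (abs_nonneg _)]
    convert h3 using 3
    rw [hq]
    field_simp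
    ring

theorem exists_isProbabilityMeasure_isMulRightInvariant (G : Type*) [Group G] [TopologicalSpace G]
    [IsTopologicalGroup G] [CompactSpace G] [MeasurableSpace G] [BorelSpace G] :
    ∃ ν : Measure G, IsProbabilityMeasure ν ∧ ν.IsMulRightInvariant := by
  have h : IsProbabilityMeasure (Measure.haarMeasure (⊤ : TopologicalSpace.PositiveCompacts G)) :=
    ⟨by simpa using Measure.haarMeasure_self (K₀ := (⊤ : TopologicalSpace.PositiveCompacts G))⟩
  exact ⟨(Measure.haarMeasure (⊤ : TopologicalSpace.PositiveCompacts G)).inv,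
    Measure.isProbabilityMeasure_map measurable_inv.aemeasurable, inferInstance⟩

section

variable {E : Type*} [NormedAddCommGroup E] [InnerProductSpace ℝ E] [FiniteDimensional ℝ E]

theorem compactSpace_unitary_clm : CompactSpace (unitary (E →L[ℝ] E)) := by
  have : ProperSpace (E →L[ℝ] E) := FiniteDimensional.proper ℝ _
  refine isCompact_iff_compactSpace.1 ?_
  refine (isCompact_closedBall (0 : E →L[ℝ] E) 1).of_isClosed_subset isClosed_unitary ?_
  intro U hU
  rw [mem_closedBall_zero_iff]
  refine U.opNorm_le_bound zero_le_one fun x => ?_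
  rw [one_mul, Unitary.norm_map ⟨U, hU⟩ x]

theorem exists_unitary_clm_apply_eq {v w : E} (h : ‖v‖ = ‖w‖) :
    ∃ V : unitary (E →L[ℝ] E), (V : E →L[ℝ] E) v = w :=
  ⟨Unitary.linearIsometryEquiv.symm (Submodule.reflection (ℝ ∙ (v - w))ᗮ),
    Submodule.reflection_sub h⟩

variable [MeasurableSpace E] [BorelSpace E]

open scoped Pointwise in
theorem lintegral_toSphere_comp_isometry (L : E ≃ₗᵢ[ℝ] E) {F : E → ENNReal} (hF : Measurable F) :
    ∫⁻ e : sphere (0 : E) 1, F (L e) ∂(volume : Measure E).toSphere =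
      ∫⁻ e : sphere (0 : E) 1, F e ∂(volume : Measure E).toSphere := by
  set T : sphere (0 : E) 1 → sphere (0 : E) 1 := fun e => ⟨L e, by simp⟩ with hT
  have hTc : Continuous T := by fun_prop
  have hTm : MeasurePreserving T (volume : Measure E).toSphere (volume : Measure E).toSphere := by
    refine ⟨hTc.measurable, Measure.ext fun s hs => ?_⟩
    rw [Measure.map_apply hTc.measurable hs, Measure.toSphere_apply' _ hs,
      Measure.toSphere_apply' _ (hTc.measurable hs)]
    congr 1
    have hset : Ioo (0 : ℝ) 1 • ((↑) '' (T ⁻¹' s) : Set E) =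
        L ⁻¹' (Ioo (0 : ℝ) 1 • ((↑) '' s : Set E)) := by
      ext x
      simp only [mem_smul, mem_image, mem_preimage, exists_exists_and_eq_and]
      constructor
      · rintro ⟨r, hr, e, he, rfl⟩
        exact ⟨r, hr, T e, he, by simp [hT]⟩
      · rintro ⟨r, hr, e, he, hx⟩
        refine ⟨r, hr, ⟨L.symm e, by simp⟩, by simpa [hT] using he, ?_⟩
        rw [← map_smul, hx, L.symm_apply_apply]
    rw [hset]
    exact L.measurePreserving.measure_preimage_equiv (f := L.toMeasurableEquiv) _
  exact hTm.lintegral_comp (f := fun e : sphere (0 : E) 1 => F e)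
    (hF.comp measurable_subtype_coe)

theorem lintegral_unitary_clm_mul_toSphere_univ (ν : Measure (unitary (E →L[ℝ] E)))
    [IsProbabilityMeasure ν] [ν.IsMulRightInvariant] {F : E → ENNReal} (hF : Measurable F)
    {v : E} (hv : ‖v‖ = 1) :
    (∫⁻ U, F ((U : E →L[ℝ] E) v) ∂ν) * (volume : Measure E).toSphere univ =
      ∫⁻ e : sphere (0 : E) 1, F e ∂(volume : Measure E).toSphere := by
  have hprop : ProperSpace (E →L[ℝ] E) := FiniteDimensional.proper ℝ _
  have hconst : ∀ e : sphere (0 : E) 1, ∫⁻ U, F ((U : E →L[ℝ] E) e) ∂ν =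
      ∫⁻ U, F ((U : E →L[ℝ] E) v) ∂ν := by
    intro e
    obtain ⟨V, hV⟩ := exists_unitary_clm_apply_eq (v := (e : E)) (w := v) (by simp [hv])
    rw [← lintegral_mul_right_eq_self _ V]
    simp [← hV]
  have hm : Measurable fun p : (sphere (0 : E) 1) × unitary (E →L[ℝ] E) =>
      F ((p.2 : E →L[ℝ] E) p.1) := by
    refine hF.comp (Continuous.measurable ?_)
    fun_prop
  calc _ = ∫⁻ e : sphere (0 : E) 1, (∫⁻ U, F ((U : E →L[ℝ] E) e) ∂ν)
        ∂(volume : Measure E).toSphere := by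
        simp_rw [hconst, lintegral_const]
    _ = ∫⁻ U, (∫⁻ e : sphere (0 : E) 1, F ((U : E →L[ℝ] E) e) ∂(volume : Measure E).toSphere)
        ∂ν := lintegral_lintegral_swap hm.aemeasurable
    _ = ∫⁻ U, (∫⁻ e : sphere (0 : E) 1, F e ∂(volume : Measure E).toSphere) ∂ν :=
        lintegral_congr fun U =>
          lintegral_toSphere_comp_isometry (Unitary.linearIsometryEquiv U) hF
    _ = _ := by simp

universe u in
/-- A probability measure on the isometry group whose orbit maps average over the sphere. -/
theorem exists_random_isometry (E : Type u) [NormedAddCommGroup E] [InnerProductSpace ℝ E]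
    [FiniteDimensional ℝ E] [MeasurableSpace E] [BorelSpace E] :
    ∃ (G : Type u) (_ : MeasurableSpace G) (ν : Measure G) (ρ : G → E ≃ₗᵢ[ℝ] E),
      IsProbabilityMeasure ν ∧ (∀ v, Measurable fun g => ρ g v) ∧
      ∀ F : E → ENNReal, Measurable F → ∀ v : E, ‖v‖ = 1 →
        (∫⁻ g, F (ρ g v) ∂ν) * (volume : Measure E).toSphere univ =
          ∫⁻ e : sphere (0 : E) 1, F e ∂(volume : Measure E).toSphere := by
  have hcpt := compactSpace_unitary_clm (E := E)
  obtain ⟨ν, hν, hνr⟩ := exists_isProbabilityMeasure_isMulRightInvariant (unitary (E →L[ℝ] E))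
  refine ⟨_, inferInstance, ν, Unitary.linearIsometryEquiv, hν, fun v => ?_, fun F hF v hv =>
    lintegral_unitary_clm_mul_toSphere_univ ν hF hv⟩
  have h : Continuous fun U : unitary (E →L[ℝ] E) => (U : E →L[ℝ] E) v := by fun_prop
  exact h.measurable

end

theorem Measurable.hardy_density {α : Type*} [MeasurableSpace α] {N : ℕ}
    {Ω : Set (EuclideanSpace ℝ (Fin N))} (hΩ : IsOpen Ω)
    {u : EuclideanSpace ℝ (Fin N) → ℝ} (hu : Measurable u) {f g : α → EuclideanSpace ℝ (Fin N)}
    (hf : Measurable f) (hg : Measurable g) :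
    Measurable fun a => ENNReal.ofReal (u (f a) ^ 2 / 4) *
      ENNReal.ofReal (dirDist Ω (f a) (g a) ^ 2)⁻¹ := by
  have h := Measurable.comp (measurable_hardy_density hΩ hu) (hf.prodMk hg)
  exact h

theorem measurable_lintegral_inv_dirDist_sq {N : ℕ} {Ω : Set (EuclideanSpace ℝ (Fin N))}
    (hΩ : IsOpen Ω) :
    Measurable fun x : EuclideanSpace ℝ (Fin N) =>
      ∫⁻ e : sphere (0 : EuclideanSpace ℝ (Fin N)) 1, ENNReal.ofReal (dirDist Ω x e ^ 2)⁻¹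
        ∂(volume : Measure (EuclideanSpace ℝ (Fin N))).toSphere := by
  have h2 : Measurable fun p : EuclideanSpace ℝ (Fin N) × sphere (0 : EuclideanSpace ℝ (Fin N)) 1 =>
      (p.2 : EuclideanSpace ℝ (Fin N)) := measurable_subtype_coe.comp measurable_snd
  have h := Measurable.comp (measurable_dirDist hΩ) (measurable_fst.prodMk h2)
  exact (h.pow_const 2).inv.ennreal_ofReal.lintegral_prod_right'

/-- The Hardy inequality with the spherical average of the squared inverse directional distances,
with a Sobolev remainder term. -/
theorem rpow_lintegral_add_hardy_average_le {N : ℕ} (hN : 3 ≤ N)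
    {Ω : Set (EuclideanSpace ℝ (Fin N))} (hΩ : IsOpen Ω)
    {u : EuclideanSpace ℝ (Fin N) → ℝ} (hu : ContDiff ℝ 1 u) (hc : HasCompactSupport u)
    (hs : tsupport u ⊆ Ω) {q : ℝ} (hq : q = 2 * N / (N - 2)) :
    (∫⁻ x, ENNReal.ofReal (|u x| ^ q)) ^ ((N - 2) / N : ℝ) +
      ENNReal.ofReal (lineConst (q / 2 + 1) ^ 2) * N ^ 2 *
        ∫⁻ x, N * (ENNReal.ofReal (u x ^ 2 / 4) *
          ((volume : Measure (EuclideanSpace ℝ (Fin N))).toSphere univ)⁻¹ *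
            ∫⁻ e : sphere (0 : EuclideanSpace ℝ (Fin N)) 1, ENNReal.ofReal (dirDist Ω x e ^ 2)⁻¹
              ∂(volume : Measure (EuclideanSpace ℝ (Fin N))).toSphere) ≤
    ENNReal.ofReal (lineConst (q / 2 + 1) ^ 2) * N ^ 2 *
      ∫⁻ x, ENNReal.ofReal (‖fderiv ℝ u x‖ ^ 2) := by
  have hN0 : NeZero N := ⟨by omega⟩
  obtain ⟨G, _, ν, ρ, hν, hρ, hav⟩ := exists_random_isometry (EuclideanSpace ℝ (Fin N))
  have hum := hu.continuous.measurable
  have hσ0 : (volume : Measure (EuclideanSpace ℝ (Fin N))).toSphere univ ≠ 0 :=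
    Measure.measure_univ_ne_zero.2
      (volume : Measure (EuclideanSpace ℝ (Fin N))).toSphere_ne_zero
  have hmeas : ∀ v : EuclideanSpace ℝ (Fin N), Measurable fun p :
      G × EuclideanSpace ℝ (Fin N) => ENNReal.ofReal (u p.2 ^ 2 / 4) *
        ENNReal.ofReal (dirDist Ω p.2 (ρ p.1 v) ^ 2)⁻¹ := by
    intro v
    refine Measurable.hardy_density hΩ hum measurable_snd ((hρ v).comp measurable_fst)
  set C := ENNReal.ofReal (lineConst (q / 2 + 1) ^ 2) * (N : ENNReal) ^ 2
  set R := C * ∫⁻ x, ENNReal.ofReal (‖fderiv ℝ u x‖ ^ 2) with hR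
  set H := (∫⁻ x, ENNReal.ofReal (|u x| ^ q)) ^ ((N - 2) / N : ℝ) with hH
  have hCtop : C ≠ ⊤ := ENNReal.mul_ne_top ENNReal.ofReal_ne_top (by simp)
  have hrot : ∀ U : G,
      H + C * ∑ i, ∫⁻ x, ENNReal.ofReal (u x ^ 2 / 4) * ENNReal.ofReal (dirDist Ω x
        (ρ U (EuclideanSpace.single i 1)) ^ 2)⁻¹ ≤ R := by
    intro U
    simpa only [OrthonormalBasis.map_apply, EuclideanSpace.basisFun_apply] using
      rpow_lintegral_add_hardy_frame_le hN hΩ hu hc hs hq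
      ((EuclideanSpace.basisFun (Fin N) ℝ).map (ρ U))
  have hint : ∫⁻ U, (H + C * ∑ i, ∫⁻ x, ENNReal.ofReal (u x ^ 2 / 4) * ENNReal.ofReal (dirDist Ω x
        (ρ U (EuclideanSpace.single i 1)) ^ 2)⁻¹) ∂ν ≤ R :=
    (lintegral_mono hrot).trans (by simp)
  rw [lintegral_add_left measurable_const, lintegral_const_mul' _ _ hCtop,
    lintegral_finsetSum _ fun i _ =>
      (hmeas (EuclideanSpace.single i 1)).lintegral_prod_right'] at hint
  simp only [lintegral_const, measure_univ, mul_one] at hint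
  convert hint using 3
  have hterm : ∀ i : Fin N, ∫⁻ U, (∫⁻ x, ENNReal.ofReal (u x ^ 2 / 4) *
      ENNReal.ofReal (dirDist Ω x (ρ U
        (EuclideanSpace.single i 1)) ^ 2)⁻¹) ∂ν =
      ∫⁻ x, ENNReal.ofReal (u x ^ 2 / 4) *
          ((volume : Measure (EuclideanSpace ℝ (Fin N))).toSphere univ)⁻¹ *
            ∫⁻ e : sphere (0 : EuclideanSpace ℝ (Fin N)) 1, ENNReal.ofReal (dirDist Ω x e ^ 2)⁻¹
              ∂(volume : Measure (EuclideanSpace ℝ (Fin N))).toSphere := by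
    intro i
    rw [lintegral_lintegral_swap (hmeas (EuclideanSpace.single i 1)).aemeasurable]
    refine lintegral_congr fun x => ?_
    have hd : Measurable fun e => dirDist Ω x e := by
      have h := Measurable.comp (measurable_dirDist hΩ) (measurable_prodMk_left (x := x))
      exact h
    rw [lintegral_const_mul' _ _ ENNReal.ofReal_ne_top,
      ← hav (fun e => ENNReal.ofReal (dirDist Ω x e ^ 2)⁻¹) (hd.pow_const 2).inv.ennreal_ofReal
        (EuclideanSpace.single i 1) (by simp), mul_assoc, mul_comm _ (Measure.toSphere _ _),
      ENNReal.inv_mul_cancel_left hσ0 (measure_ne_top _ _)]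
  simp only [hterm, Finset.sum_const, Finset.card_univ, Fintype.card_fin, nsmul_eq_mul]
  rw [lintegral_const_mul' _ _ (by simp)]

theorem ofReal_average_inv_dirDist_sq {N : ℕ} {Ω : Set (EuclideanSpace ℝ (Fin N))}
    (hΩ : IsOpen Ω) {x : EuclideanSpace ℝ (Fin N)} (hx : x ∈ Ω) :
    ENNReal.ofReal (⨍ e : sphere (0 : EuclideanSpace ℝ (Fin N)) 1,
      (dirDist Ω x (e : EuclideanSpace ℝ (Fin N)) ^ 2)⁻¹ ∂volume.toSphere) =
    ((volume : Measure (EuclideanSpace ℝ (Fin N))).toSphere univ)⁻¹ *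
      ∫⁻ e : sphere (0 : EuclideanSpace ℝ (Fin N)) 1, ENNReal.ofReal (dirDist Ω x e ^ 2)⁻¹
        ∂(volume : Measure (EuclideanSpace ℝ (Fin N))).toSphere := by
  obtain ⟨δ, hδ, hball⟩ := Metric.isOpen_iff.1 hΩ x hx
  have hm : Measurable fun e : sphere (0 : EuclideanSpace ℝ (Fin N)) 1 =>
      (dirDist Ω x (e : EuclideanSpace ℝ (Fin N)) ^ 2)⁻¹ := by
    have h := Measurable.comp (measurable_dirDist hΩ) ((measurable_prodMk_left (x := x)).comp
      (measurable_subtype_coe (p := (· ∈ sphere (0 : EuclideanSpace ℝ (Fin N)) 1))))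
    exact (h.pow_const 2).inv
  have hint : Integrable (fun e : sphere (0 : EuclideanSpace ℝ (Fin N)) 1 =>
      (dirDist Ω x (e : EuclideanSpace ℝ (Fin N)) ^ 2)⁻¹)
      (volume : Measure (EuclideanSpace ℝ (Fin N))).toSphere := by
    refine Integrable.of_bound hm.aestronglyMeasurable (δ ^ 2)⁻¹ (ae_of_all _ fun e => ?_)
    rw [Real.norm_of_nonneg (by positivity)]
    exact inv_dirDist_sq_le hδ (by simp) hball
  rw [average_eq, smul_eq_mul,
    ENNReal.ofReal_mul (by positivity),
    ofReal_integral_eq_lintegral_ofReal hint (ae_of_all _ fun e => by positivity)]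
  rcases eq_or_ne ((volume : Measure (EuclideanSpace ℝ (Fin N))).toSphere univ) 0 with h0 | h0
  · simp [Measure.measure_univ_eq_zero.1 h0]
  · have hpos : 0 < (volume : Measure (EuclideanSpace ℝ (Fin N))).toSphere.real univ :=
      ENNReal.toReal_pos h0 (measure_ne_top _ _)
    rw [ENNReal.ofReal_inv_of_pos hpos, ofReal_measureReal]

theorem inv_four_mul_daviesWeight_sq {N : ℕ} (Ω : Set (EuclideanSpace ℝ (Fin N)))
    (x : EuclideanSpace ℝ (Fin N)) :
    (4 * daviesWeight Ω x ^ 2)⁻¹ =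
      N / 4 * ⨍ e : sphere (0 : EuclideanSpace ℝ (Fin N)) 1,
        (dirDist Ω x (e : EuclideanSpace ℝ (Fin N)) ^ 2)⁻¹ ∂volume.toSphere := by
  have h0 : 0 ≤ ⨍ e : sphere (0 : EuclideanSpace ℝ (Fin N)) 1,
      (dirDist Ω x (e : EuclideanSpace ℝ (Fin N)) ^ 2)⁻¹ ∂volume.toSphere :=
    integral_nonneg fun e => by positivity
  rw [daviesWeight, ← Real.rpow_natCast, ← Real.rpow_mul (by positivity)]
  norm_num [Real.rpow_neg_one]
  ring

theorem ofReal_sq_div_daviesWeight {N : ℕ} {Ω : Set (EuclideanSpace ℝ (Fin N))}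
    (hΩ : IsOpen Ω) {u : EuclideanSpace ℝ (Fin N) → ℝ} (hs : tsupport u ⊆ Ω)
    (x : EuclideanSpace ℝ (Fin N)) :
    ENNReal.ofReal (u x ^ 2 / (4 * daviesWeight Ω x ^ 2)) =
      N * (ENNReal.ofReal (u x ^ 2 / 4) *
        ((volume : Measure (EuclideanSpace ℝ (Fin N))).toSphere univ)⁻¹ *
          ∫⁻ e : sphere (0 : EuclideanSpace ℝ (Fin N)) 1, ENNReal.ofReal (dirDist Ω x e ^ 2)⁻¹
            ∂(volume : Measure (EuclideanSpace ℝ (Fin N))).toSphere) := by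
  by_cases hx : x ∈ Ω
  · rw [mul_assoc, ← ofReal_average_inv_dirDist_sq hΩ hx, ← ENNReal.ofReal_mul (by positivity),
      ← ENNReal.ofReal_natCast, ← ENNReal.ofReal_mul (by positivity), div_eq_mul_inv,
      inv_four_mul_daviesWeight_sq]
    congr 1
    ring
  · simp [image_eq_zero_of_notMem_tsupport fun h => hx (hs h)]

/-- **Hardy–Sobolev–Maz'ya inequality** (Theorem 1): for `N ≥ 3` there is a constant `K_N > 0`,
depending only on `N`, such that for every domain (open connected proper subset) `Ω ⊊ ℝ^N`
and every `u ∈ C_0^∞(Ω)`,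
`∫_Ω (|∇u|² − |u|²/(4 D_Ω²)) dx ≥ K_N (∫_Ω |u|^{2N/(N−2)} dx)^{(N−2)/N}`. -/
theorem hardy_sobolev_mazya (N : ℕ) (hN : 3 ≤ N) :
    ∃ K : ℝ, 0 < K ∧
      ∀ (Ω : Set (EuclideanSpace ℝ (Fin N))), IsOpen Ω → IsConnected Ω → Ω ≠ Set.univ →
        ∀ u : EuclideanSpace ℝ (Fin N) → ℝ,
          ContDiff ℝ (⊤ : ℕ∞) u → HasCompactSupport u → tsupport u ⊆ Ω →
          K * (∫ x in Ω, |u x| ^ (2 * (N : ℝ) / ((N : ℝ) - 2))) ^ (((N : ℝ) - 2) / (N : ℝ)) ≤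
            ∫ x in Ω, (‖fderiv ℝ u x‖ ^ 2 - u x ^ 2 / (4 * daviesWeight Ω x ^ 2)) := by
  have hN' : (3 : ℝ) ≤ N := by exact_mod_cast hN
  have hN2 : (0 : ℝ) < N - 2 := by linarith
  obtain ⟨q, hq⟩ : ∃ q : ℝ, q = 2 * N / (N - 2) := ⟨_, rfl⟩
  have hq0 : 0 < q := by rw [hq]; positivity
  obtain ⟨k, hk⟩ : ∃ k : ℝ, k = lineConst (q / 2 + 1) ^ 2 * N ^ 2 := ⟨_, rfl⟩
  have hk0 : 0 < k := by
    have := lineConst_pos (p := q / 2 + 1) (by positivity)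
    rw [hk]; positivity
  refine ⟨k⁻¹, inv_pos.2 hk0, fun Ω hΩ _ _ u hu hc hs => ?_⟩
  have hu1 : ContDiff ℝ 1 u := hu.of_le (by exact_mod_cast le_top)
  have hzero : ∀ x, x ∉ Ω → x ∉ tsupport u := fun x hx h => hx (hs h)
  have hmain := rpow_lintegral_add_hardy_average_le hN hΩ hu1 hc hs hq
  simp_rw [← ofReal_sq_div_daviesWeight hΩ hs] at hmain
  rw [← hq]
  have hGc : Continuous fun x => ‖fderiv ℝ u x‖ ^ 2 := by
    have := hu1.continuous_fderiv one_ne_zero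
    fun_prop
  have hGs : HasCompactSupport fun x => ‖fderiv ℝ u x‖ ^ 2 :=
    (hc.fderiv ℝ).comp_left (g := fun l : EuclideanSpace ℝ (Fin N) →L[ℝ] ℝ => ‖l‖ ^ 2) (by simp)
  have hGint : Integrable fun x => ‖fderiv ℝ u x‖ ^ 2 := hGc.integrable_of_hasCompactSupport hGs
  have hHc : Continuous fun x => |u x| ^ q :=
    hu1.continuous.abs.rpow_const fun x => Or.inr hq0.le
  have hHs : HasCompactSupport fun x => |u x| ^ q :=
    hc.comp_left (g := fun r : ℝ => |r| ^ q) (by simp [Real.zero_rpow hq0.ne'])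
  have hHint : Integrable fun x => |u x| ^ q := hHc.integrable_of_hasCompactSupport hHs
  have hC : ENNReal.ofReal (lineConst (q / 2 + 1) ^ 2) * (N : ENNReal) ^ 2 = ENNReal.ofReal k := by
    rw [hk, ENNReal.ofReal_mul (by positivity), ENNReal.ofReal_pow (Nat.cast_nonneg N) 2,
      ENNReal.ofReal_natCast]
  have hW0 : ∀ x, 0 ≤ u x ^ 2 / (4 * daviesWeight Ω x ^ 2) := fun x => by positivity
  have hWm : Measurable fun x => u x ^ 2 / (4 * daviesWeight Ω x ^ 2) := by
    have h : Measurable fun x => ENNReal.ofReal (u x ^ 2 / (4 * daviesWeight Ω x ^ 2)) := by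
      simp_rw [ofReal_sq_div_daviesWeight hΩ hs]
      exact ((((hu1.continuous.measurable.pow_const 2).div_const 4).ennreal_ofReal.mul_const
        _).mul (measurable_lintegral_inv_dirDist_sq hΩ)).const_mul _
    simpa only [ENNReal.toReal_ofReal (hW0 _)] using h.ennreal_toReal
  rw [hC] at hmain
  have hWint : Integrable fun x => u x ^ 2 / (4 * daviesWeight Ω x ^ 2) := by
    refine ⟨hWm.aestronglyMeasurable, ?_⟩
    rw [hasFiniteIntegral_iff_ofReal (ae_of_all _ hW0)]
    have h1 := le_add_self.trans hmain
    rw [ENNReal.mul_le_mul_iff_right (by simpa using hk0) ENNReal.ofReal_ne_top] at h1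
    exact h1.trans_lt hGint.lintegral_lt_top
  rw [← ofReal_integral_eq_lintegral_ofReal hGint (ae_of_all _ fun x => by positivity),
    ← ofReal_integral_eq_lintegral_ofReal hHint (ae_of_all _ fun x => by positivity),
    ← ofReal_integral_eq_lintegral_ofReal hWint (ae_of_all _ hW0),
    ENNReal.ofReal_rpow_of_nonneg (integral_nonneg fun x => by positivity) (by positivity),
    ← ENNReal.ofReal_mul hk0.le, ← ENNReal.ofReal_mul hk0.le,
    ← ENNReal.ofReal_add (Real.rpow_nonneg (integral_nonneg fun x => by positivity) _)
      (mul_nonneg hk0.le (integral_nonneg hW0)),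
    ENNReal.ofReal_le_ofReal_iff
      (mul_nonneg hk0.le (integral_nonneg fun x => by positivity))] at hmain
  rw [setIntegral_eq_integral_of_forall_compl_eq_zero fun x hx => by
      simp [image_eq_zero_of_notMem_tsupport (hzero x hx), Real.zero_rpow hq0.ne'],
    setIntegral_eq_integral_of_forall_compl_eq_zero fun x hx => by
      simp [image_eq_zero_of_notMem_tsupport (hzero x hx),
        image_eq_zero_of_notMem_tsupport fun h => hzero x hx (tsupport_fderiv_subset ℝ h)],
    integral_sub hGint hWint, inv_mul_le_iff₀ hk0]
  linarith
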